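/- arXiv:1602.00591 — 2 statements merged into one kernel-verified Lean document; each statement's English description precedes it below -/
import Mathlib

section
/- Define the transition matrices P[n, l] := W[n] W[n−1] ⋯ W[l] for all n ≥ l ≥ 0 (with P[n, n] = W[n]). Then there exist constants c₀ > 0 and ρ ∈ (0, 1) such that ‖P[n, l] − (1/I)𝟙𝟙ᵀ‖ ≤ c₀ ρ^{n − l + 1} for all n ≥ l ≥ 0, where 𝟙 is the all-ones vector in ℝ^I. -/
attribute [local instance] Matrix.frobeniusNormedAddCommGroup

open Finset Matrix

section TransitionMatrices

variable {ι : Type*} [Fintype ι]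

/-- A matrix with entries at least `η` and unit column sums contracts the entrywise `ℓ¹` norm
on matrices with zero column sums. -/
lemma sum_abs_mul_le {M D : Matrix ι ι ℝ} {η : ℝ} (hM : ∀ i j, η ≤ M i j)
    (hcol : ∀ j, ∑ i, M i j = 1) (hD : ∀ j, ∑ i, D i j = 0) :
    ∑ j, ∑ i, |(M * D) i j| ≤ (1 - Fintype.card ι * η) * ∑ j, ∑ i, |D i j| := by
  rw [mul_sum]
  refine sum_le_sum fun j _ => ?_
  calc ∑ i, |(M * D) i j| = ∑ i, |∑ k, (M i k - η) * D k j| := by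
        simp [Matrix.mul_apply, sub_mul, sum_sub_distrib, ← mul_sum, hD]
    _ ≤ ∑ i, ∑ k, (M i k - η) * |D k j| := by
        refine sum_le_sum fun i _ => (abs_sum_le_sum_abs _ _).trans_eq ?_
        exact sum_congr rfl fun k _ => by rw [abs_mul, abs_of_nonneg (sub_nonneg.2 (hM i k))]
    _ = (1 - Fintype.card ι * η) * ∑ i, |D i j| := by
        rw [sum_comm, mul_sum]
        simp [← sum_mul, sum_sub_distrib, hcol]

/-- The entrywise `ℓ¹` distance from a matrix to the averaging matrix. -/
noncomputable def consensusError (A : Matrix ι ι ℝ) : ℝ :=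
  ∑ j, ∑ i, |A i j - 1 / Fintype.card ι|

lemma consensusError_nonneg (A : Matrix ι ι ℝ) : 0 ≤ consensusError A :=
  sum_nonneg fun _ _ => sum_nonneg fun _ _ => abs_nonneg _

lemma frobenius_norm_le_sum_abs (A : Matrix ι ι ℝ) : ‖A‖ ≤ ∑ j, ∑ i, |A i j| := by
  rw [frobenius_norm_def, ← Real.sqrt_eq_rpow, sum_comm, ← sum_product', ← sum_product']
  refine Real.sqrt_le_iff.2 ⟨sum_nonneg fun _ _ => abs_nonneg _, ?_⟩
  simpa using sum_sq_le_sq_sum_of_nonneg (s := univ ×ˢ univ) (f := fun p : ι × ι => |A p.2 p.1|)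
    fun _ _ => abs_nonneg _

variable [DecidableEq ι]

/-- The product `W (l + m - 1) * ⋯ * W (l + 1) * W l` of `m` consecutive matrices. -/
def transitionProd (W : ℕ → Matrix ι ι ℝ) (l : ℕ) : ℕ → Matrix ι ι ℝ
  | 0 => 1
  | m + 1 => W (l + m) * transitionProd W l m

lemma transitionProd_add (W : ℕ → Matrix ι ι ℝ) (l a b : ℕ) :
    transitionProd W l (a + b) = transitionProd W (l + a) b * transitionProd W l a := by
  induction b with
  | zero => simp [transitionProd]
  | succ b ih => rw [← add_assoc, transitionProd, ih, transitionProd, Matrix.mul_assoc, add_assoc]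

lemma transitionProd_mem_doublyStochastic {W : ℕ → Matrix ι ι ℝ}
    (hW : ∀ n, W n ∈ doublyStochastic ℝ ι) (l m : ℕ) :
    transitionProd W l m ∈ doublyStochastic ℝ ι := by
  induction m with
  | zero => exact one_mem _
  | succ m ih => exact mul_mem (hW _) ih

/-- A single edge of the last factor bounds an entry of the product from below. -/
lemma pow_le_transitionProd_succ {W : ℕ → Matrix ι ι ℝ} (hW : ∀ n, W n ∈ doublyStochastic ℝ ι)
    {θ : ℝ} (hθ : 0 ≤ θ) {l m : ℕ} {u v j : ι} (hu : θ ^ m ≤ transitionProd W l m u j)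
    (hvu : θ ≤ W (l + m) v u) : θ ^ (m + 1) ≤ transitionProd W l (m + 1) v j := by
  have hQ := transitionProd_mem_doublyStochastic hW l m
  calc θ ^ (m + 1) = θ * θ ^ m := pow_succ' θ m
    _ ≤ W (l + m) v u * transitionProd W l m u j :=
        mul_le_mul hvu hu (pow_nonneg hθ m) (hθ.trans hvu)
    _ ≤ ∑ k, W (l + m) v k * transitionProd W l m k j :=
        single_le_sum
          (f := fun k => W (l + m) v k * transitionProd W l m k j)
          (fun k _ => mul_nonneg (nonneg_of_mem_doublyStochastic (hW _))
            (nonneg_of_mem_doublyStochastic hQ)) (mem_univ u)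
    _ = transitionProd W l (m + 1) v j := by rw [transitionProd, Matrix.mul_apply]

open Classical in
/-- The indices `i` for which the `(i, j)` entry of the `m`-fold product is at least `θ ^ m`. -/
noncomputable def reachedSet (W : ℕ → Matrix ι ι ℝ) (θ : ℝ) (l : ℕ) (j : ι) (m : ℕ) : Finset ι :=
  {i | θ ^ m ≤ transitionProd W l m i j}

lemma mem_reachedSet {W : ℕ → Matrix ι ι ℝ} {θ : ℝ} {l m : ℕ} {i j : ι} :
    i ∈ reachedSet W θ l j m ↔ θ ^ m ≤ transitionProd W l m i j := by
  simp [reachedSet]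

lemma reachedSet_mono {W : ℕ → Matrix ι ι ℝ} (hW : ∀ n, W n ∈ doublyStochastic ℝ ι)
    {θ : ℝ} (hθ : 0 ≤ θ) (hdiag : ∀ n i, θ ≤ W n i i) (l : ℕ) (j : ι) :
    Monotone (reachedSet W θ l j) :=
  monotone_nat_of_le_succ fun _ i hi => mem_reachedSet.2
    (pow_le_transitionProd_succ hW hθ (mem_reachedSet.1 hi) (hdiag _ i))

lemma self_mem_reachedSet {W : ℕ → Matrix ι ι ℝ} (hW : ∀ n, W n ∈ doublyStochastic ℝ ι)
    {θ : ℝ} (hθ : 0 ≤ θ) (hdiag : ∀ n i, θ ≤ W n i i) (l : ℕ) (j : ι) (m : ℕ) :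
    j ∈ reachedSet W θ l j m :=
  reachedSet_mono hW hθ hdiag l j (Nat.zero_le m) (mem_reachedSet.2 (by simp [transitionProd]))

/-- Over a strongly connected block of times, the reached set grows unless it is everything. -/
lemma reachedSet_ssubset {W : ℕ → Matrix ι ι ℝ} (hW : ∀ n, W n ∈ doublyStochastic ℝ ι)
    {θ : ℝ} (hθ : 0 ≤ θ) (hdiag : ∀ n i, θ ≤ W n i i)
    (hpos : ∀ n i j, 0 < W n i j → θ ≤ W n i j) {l s t : ℕ} (hls : l ≤ s) (hst : s ≤ t) {j : ι}
    (hconn : ∀ a b : ι, Relation.ReflTransGen (fun u v => ∃ n ∈ Ico s t, 0 < W n v u) a b)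
    (hne : reachedSet W θ l j (s - l) ≠ univ) :
    reachedSet W θ l j (s - l) ⊂ reachedSet W θ l j (t - l) := by
  have hmono := reachedSet_mono hW hθ hdiag l j
  refine (hmono (by omega)).ssubset_of_ne fun heq => hne (eq_univ_of_forall fun b => ?_)
  induction hconn j b with
  | refl => exact self_mem_reachedSet hW hθ hdiag l j _
  | @tail u v _ huv hu =>
    obtain ⟨n, hn, hvu⟩ := huv
    rw [mem_Ico] at hn
    have hu' := mem_reachedSet.1 (hmono (show s - l ≤ n - l by omega) hu)
    have hvu' : θ ≤ W (l + (n - l)) v u := by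
      rw [Nat.add_sub_cancel' (hls.trans hn.1)]
      exact hpos n v u hvu
    rw [heq]
    exact hmono (show n - l + 1 ≤ t - l by omega)
      (mem_reachedSet.2 (pow_le_transitionProd_succ hW hθ hu' hvu'))

lemma min_le_card_reachedSet {W : ℕ → Matrix ι ι ℝ} (hW : ∀ n, W n ∈ doublyStochastic ℝ ι)
    {θ : ℝ} (hθ : 0 ≤ θ) (hdiag : ∀ n i, θ ≤ W n i i)
    (hpos : ∀ n i j, 0 < W n i j → θ ≤ W n i j) {B : ℕ}
    (hconn : ∀ k : ℕ, ∀ a b : ι, Relation.ReflTransGen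
      (fun u v => ∃ n ∈ Ico (k * B) ((k + 1) * B), 0 < W n v u) a b)
    {l k : ℕ} (hl : l ≤ k * B) (j : ι) (t : ℕ) :
    min t (Fintype.card ι) ≤ #(reachedSet W θ l j ((k + t) * B - l)) := by
  induction t with
  | zero => simp
  | succ t ih =>
    have hle : (k + t) * B ≤ (k + t + 1) * B := Nat.mul_le_mul_right B (Nat.le_succ _)
    by_cases hne : reachedSet W θ l j ((k + t) * B - l) = univ
    · have hsub := card_le_card
        (reachedSet_mono hW hθ hdiag l j (Nat.sub_le_sub_right hle l))
      rw [hne, card_univ] at hsub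
      exact (min_le_right _ _).trans hsub
    · have hlt := card_lt_card (reachedSet_ssubset hW hθ hdiag hpos
        (hl.trans (Nat.mul_le_mul_right B (Nat.le_add_right k t))) hle (hconn (k + t)) hne)
      rw [← add_assoc]
      omega

/-- Products over `card ι + 1` blocks have entries uniformly bounded away from zero. -/
lemma pow_le_transitionProd {W : ℕ → Matrix ι ι ℝ} (hW : ∀ n, W n ∈ doublyStochastic ℝ ι)
    {θ : ℝ} (hθ : 0 ≤ θ) (hdiag : ∀ n i, θ ≤ W n i i)
    (hpos : ∀ n i j, 0 < W n i j → θ ≤ W n i j) {B : ℕ} (hB : 0 < B)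
    (hconn : ∀ k : ℕ, ∀ a b : ι, Relation.ReflTransGen
      (fun u v => ∃ n ∈ Ico (k * B) ((k + 1) * B), 0 < W n v u) a b)
    (l : ℕ) (i j : ι) :
    θ ^ ((Fintype.card ι + 1) * B) ≤ transitionProd W l ((Fintype.card ι + 1) * B) i j := by
  have hl : l ≤ (l / B + 1) * B := (Nat.lt_div_mul_add hB).le.trans_eq (by ring)
  have hcard := min_le_card_reachedSet hW hθ hdiag hpos hconn hl j (Fintype.card ι)
  rw [min_self] at hcard
  have huniv := eq_univ_of_card _ (le_antisymm (card_le_univ _) hcard)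
  refine mem_reachedSet.1 (reachedSet_mono hW hθ hdiag l j ?_ (huniv ▸ mem_univ i))
  have h := Nat.div_mul_le_self l B
  rw [Nat.sub_le_iff_le_add]
  calc (l / B + 1 + Fintype.card ι) * B = (Fintype.card ι + 1) * B + l / B * B := by ring
    _ ≤ (Fintype.card ι + 1) * B + l := by omega

lemma consensusError_mul_le [Nonempty ι] {M A : Matrix ι ι ℝ} {η : ℝ}
    (hM : M ∈ doublyStochastic ℝ ι) (hA : A ∈ doublyStochastic ℝ ι) (hη : 0 ≤ η)
    (hMη : ∀ i j, η ≤ M i j) :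
    consensusError (M * A) ≤ (1 - η) * consensusError A := by
  have hcard : (1 : ℝ) ≤ Fintype.card ι := by exact_mod_cast Fintype.card_pos (α := ι)
  rw [mem_doublyStochastic_iff_sum] at hM hA
  let J : Matrix ι ι ℝ := of fun _ _ => 1 / Fintype.card ι
  have hMJ : M * J = J := by
    ext i j
    simp [J, Matrix.mul_apply, ← sum_mul, hM.2.1]
  have hD : ∀ j, ∑ i, (A - J) i j = 0 := fun j => by
    simp [J, sum_sub_distrib, hA.2.2]
  have h := sum_abs_mul_le hMη hM.2.2 hD
  rw [Matrix.mul_sub, hMJ] at h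
  refine h.trans (mul_le_mul_of_nonneg_right ?_ (consensusError_nonneg A))
  nlinarith

lemma consensusError_transitionProd_le [Nonempty ι] {W : ℕ → Matrix ι ι ℝ}
    (hW : ∀ n, W n ∈ doublyStochastic ℝ ι) {η : ℝ} (hη : η ∈ Set.Icc (0 : ℝ) 1) {L : ℕ}
    (hL : ∀ l i j, η ≤ transitionProd W l L i j) (l q r : ℕ) :
    consensusError (transitionProd W l (L * q + r)) ≤
      (1 - η) ^ q * consensusError (1 : Matrix ι ι ℝ) := by
  have hds := transitionProd_mem_doublyStochastic hW
  rw [transitionProd_add]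
  refine (consensusError_mul_le (hds _ _) (hds _ _) le_rfl
    fun i j => nonneg_of_mem_doublyStochastic (hds _ _)).trans ?_
  rw [sub_zero, one_mul]
  induction q with
  | zero => simp [transitionProd]
  | succ q ih =>
    rw [Nat.mul_succ, transitionProd_add, pow_succ', mul_assoc]
    exact (consensusError_mul_le (hds _ _) (hds _ _) hη.1 (hL _)).trans
      (mul_le_mul_of_nonneg_left ih (sub_nonneg.2 hη.2))

end TransitionMatrices

/-- Decay by a factor `x` every `L` steps is geometric decay, up to a constant. -/
lemma exists_pow_div_le_mul_pow {x : ℝ} (hx : x ∈ Set.Ioo (0 : ℝ) 1) {L : ℕ} (hL : 0 < L) :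
    ∃ ρ ∈ Set.Ioo (0 : ℝ) 1, ∀ m : ℕ, x ^ (m / L) ≤ x⁻¹ * ρ ^ m := by
  have hρ0 : 0 < x ^ (L⁻¹ : ℝ) := Real.rpow_pos_of_pos hx.1 _
  have hρ1 : x ^ (L⁻¹ : ℝ) < 1 := Real.rpow_lt_one hx.1.le hx.2 (by positivity)
  have hρL : (x ^ (L⁻¹ : ℝ)) ^ L = x := Real.rpow_inv_natCast_pow hx.1.le hL.ne'
  refine ⟨x ^ (L⁻¹ : ℝ), ⟨hρ0, hρ1⟩, fun m => ?_⟩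
  rw [le_inv_mul_iff₀ hx.1, ← pow_succ']
  calc x ^ (m / L + 1) = (x ^ (L⁻¹ : ℝ)) ^ (L * (m / L + 1)) := by rw [pow_mul, hρL]
    _ ≤ (x ^ (L⁻¹ : ℝ)) ^ m :=
        pow_le_pow_of_le_one hρ0.le hρ1.le (Nat.lt_mul_div_succ m hL).le

/-- Geometric decay of the transition matrices `P[n,l] = W[n] W[n−1] ⋯ W[l]` towards
`(1/I)𝟙𝟙ᵀ`, under doubly stochastic weight matrices matching a `B`-strongly connected
sequence of digraphs. -/
theorem stmt_4 {I : ℕ} (hI : 0 < I)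
    (W : ℕ → Matrix (Fin I) (Fin I) ℝ)
    (θ : ℝ) (hθ : θ ∈ Set.Ioo (0 : ℝ) 1)
    (hWentries : ∀ n i j, W n i j = 0 ∨ W n i j ∈ Set.Icc θ 1)
    (hWdiag : ∀ n i, θ ≤ W n i i)
    (hWrow : ∀ n i, ∑ j, W n i j = 1)
    (hWcol : ∀ n j, ∑ i, W n i j = 1)
    (B : ℕ) (hB : 0 < B)
    (hconn : ∀ k : ℕ, ∀ a b : Fin I,
      Relation.ReflTransGen
        (fun u v : Fin I => ∃ n ∈ Finset.Ico (k * B) ((k + 1) * B), 0 < W n v u) a b)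
    (P : ℕ → ℕ → Matrix (Fin I) (Fin I) ℝ)
    (hPdiag : ∀ n, P n n = W n)
    (hPstep : ∀ l n, l ≤ n → P (n + 1) l = W (n + 1) * P n l) :
    ∃ c₀ > (0 : ℝ), ∃ ρ ∈ Set.Ioo (0 : ℝ) 1, ∀ l n, l ≤ n →
      ‖P n l - Matrix.of (fun _ _ : Fin I => (1 : ℝ) / I)‖ ≤ c₀ * ρ ^ (n - l + 1) := by
  have : Nonempty (Fin I) := ⟨⟨0, hI⟩⟩
  have hW : ∀ n, W n ∈ doublyStochastic ℝ (Fin I) := fun n =>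
    mem_doublyStochastic_iff_sum.2 ⟨fun i j => (hWentries n i j).elim (fun h => h.ge)
      fun h => hθ.1.le.trans h.1, hWrow n, hWcol n⟩
  have hpos : ∀ n i j, 0 < W n i j → θ ≤ W n i j := fun n i j h =>
    (hWentries n i j).elim (fun h0 => absurd h0 h.ne') fun h1 => h1.1
  have hP : ∀ l m, P (l + m) l = transitionProd W l (m + 1) := fun l m => by
    induction m with
    | zero => simp [hPdiag, transitionProd]
    | succ m ih => rw [← add_assoc, hPstep l _ (Nat.le_add_right l m), ih,
        add_assoc, ← transitionProd]
  obtain ⟨L, hL0, hL⟩ : ∃ L, 0 < L ∧ ∀ l i j, θ ^ L ≤ transitionProd W l L i j :=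
    ⟨_, Nat.mul_pos (Nat.succ_pos _) hB,
      pow_le_transitionProd hW hθ.1.le hWdiag hpos hB hconn⟩
  have hη0 : 0 < θ ^ L := pow_pos hθ.1 L
  have hη1 : θ ^ L < 1 := pow_lt_one₀ hθ.1.le hθ.2 hL0.ne'
  have hx : 1 - θ ^ L ∈ Set.Ioo (0 : ℝ) 1 := ⟨sub_pos.2 hη1, sub_lt_self 1 hη0⟩
  obtain ⟨ρ, hρ, hdecay⟩ := exists_pow_div_le_mul_pow hx hL0
  have hC : 0 ≤ consensusError (1 : Matrix (Fin I) (Fin I) ℝ) := consensusError_nonneg 1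
  refine ⟨(1 - θ ^ L)⁻¹ * (consensusError (1 : Matrix (Fin I) (Fin I) ℝ) + 1),
    mul_pos (inv_pos.2 hx.1) (by positivity), ρ, hρ, fun l n hln => ?_⟩
  obtain ⟨m, rfl⟩ := Nat.exists_eq_add_of_le hln
  rw [hP, Nat.add_sub_cancel_left]
  have herr := consensusError_transitionProd_le hW ⟨hη0.le, hη1.le⟩ hL l ((m + 1) / L)
    ((m + 1) % L)
  rw [Nat.div_add_mod] at herr
  calc _ ≤ consensusError (transitionProd W l (m + 1)) := by
        simpa only [consensusError, Fintype.card_fin, Matrix.sub_apply, of_apply] using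
          frobenius_norm_le_sum_abs (transitionProd W l (m + 1) -
            of fun _ _ : Fin I => (1 : ℝ) / I)
    _ ≤ (1 - θ ^ L) ^ ((m + 1) / L) * consensusError (1 : Matrix (Fin I) (Fin I) ℝ) := herr
    _ ≤ ((1 - θ ^ L)⁻¹ * ρ ^ (m + 1)) * (consensusError (1 : Matrix (Fin I) (Fin I) ℝ) + 1) :=
        mul_le_mul (hdecay _) (le_add_of_nonneg_right zero_le_one) hC
          (mul_nonneg (inv_nonneg.2 hx.1.le) (pow_nonneg hρ.1.le _))
    _ = _ := by ring
end

section
/- Let (x_i[n])_{i=1}^I, n ≥ 0, be the sequences generated by the NEXT algorithm (exact version), and let x̄[n] := (1/I) Σ_{i=1}^I x_i[n]. Suppose Assumptions A, F, B hold and the step sizes satisfy α[n] ∈ (0, 1] for all n, Σ_n α[n] = ∞ and Σ_n α[n]² < ∞. Then: (a) the sequence (x̄[n])_n is bounded and every limit point of (x̄[n])_n is a stationary solution of min_{x∈K} F(x) + G(x); and (b) for every i = 1,…,I, ‖x_i[n] − x̄[n]‖ → 0 as n → ∞. -/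
open Filter
open scoped InnerProductSpace

section RealSequences

/-- A nonnegative sequence contracting over a fixed delay, up to a bounded input, is bounded. -/
theorem bounded_of_delayed_contraction {a : ℕ → ℝ} {T : ℕ} {q b : ℝ} (ha : ∀ n, 0 ≤ a n)
    (hq1 : q < 1) (hq0 : 0 ≤ q) (hT : 0 < T) (h : ∀ n, a (n + T) ≤ q * a n + b) :
    ∃ M, ∀ n, a n ≤ M := by
  refine ⟨max (∑ n ∈ Finset.range T, a n) (b / (1 - q)), fun n => ?_⟩
  induction n using Nat.strong_induction_on with
  | _ n ih =>
    rcases lt_or_ge n T with hn | hn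
    · exact le_max_of_le_left
        (Finset.single_le_sum (fun i _ => ha i) (Finset.mem_range.2 hn))
    · obtain ⟨k, rfl⟩ := Nat.exists_eq_add_of_le' hn
      have h1 := ih k (by omega)
      set M := max (∑ n ∈ Finset.range T, a n) (b / (1 - q))
      have h2 : b / (1 - q) ≤ M := le_max_right _ _
      rw [div_le_iff₀ (by linarith)] at h2
      nlinarith [h k, mul_le_mul_of_nonneg_left h1 hq0]

/-- A contraction over a fixed delay maps square-summable inputs to square-summable outputs. -/
theorem summable_sq_of_delayed_contraction {a d : ℕ → ℝ} {T : ℕ} {q c : ℝ} (ha : ∀ n, 0 ≤ a n)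
    (hq1 : q < 1) (hq0 : 0 ≤ q)
    (h : ∀ n, a (n + T) ≤ q * a n + c * ∑ l ∈ Finset.range T, d (n + l))
    (hd : Summable fun n => d n ^ 2) : Summable fun n => a n ^ 2 := by
  have hq : 0 < 1 - q := by linarith
  set b : ℕ → ℝ := fun n => c * ∑ l ∈ Finset.range T, d (n + l) with hb
  have hbs : Summable fun n => b n ^ 2 := by
    have h1 : Summable fun n => c ^ 2 * (T * ∑ l ∈ Finset.range T, d (n + l) ^ 2) := by
      refine Summable.mul_left _ (Summable.mul_left _ (summable_sum fun l _ => ?_))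
      exact (summable_nat_add_iff (f := fun n => d n ^ 2) l).2 hd
    refine Summable.of_nonneg_of_le (fun n => sq_nonneg _) (fun n => ?_) h1
    rw [hb, mul_pow]
    refine mul_le_mul_of_nonneg_left ?_ (sq_nonneg _)
    simpa using sq_sum_le_card_mul_sum_sq (s := Finset.range T) (f := fun l => d (n + l))
  have hstep : ∀ n, a (n + T) ^ 2 ≤ q * a n ^ 2 + b n ^ 2 / (1 - q) := by
    intro n
    have h1 : a (n + T) ^ 2 ≤ (q * a n + b n) ^ 2 := pow_le_pow_left₀ (ha _) (h n) 2
    refine h1.trans ?_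
    have : q * a n ^ 2 + b n ^ 2 / (1 - q) - (q * a n + b n) ^ 2
        = q * ((1 - q) * a n - b n) ^ 2 / (1 - q) := by
      field_simp; ring
    have : 0 ≤ q * ((1 - q) * a n - b n) ^ 2 / (1 - q) := by positivity
    linarith
  refine summable_of_sum_range_le (c := (∑ n ∈ Finset.range T, a n ^ 2
    + (∑' n, b n ^ 2) / (1 - q)) / (1 - q)) (fun n => sq_nonneg _) (fun N => ?_)
  rw [le_div_iff₀ hq]
  have h1 : ∑ n ∈ Finset.range N, a n ^ 2 ≤ ∑ n ∈ Finset.range (T + N), a n ^ 2 :=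
    Finset.sum_le_sum_of_subset_of_nonneg (Finset.range_mono (by omega))
      (fun _ _ _ => sq_nonneg _)
  rw [Finset.sum_range_add] at h1
  have h2 : ∑ n ∈ Finset.range N, a (T + n) ^ 2
      ≤ q * ∑ n ∈ Finset.range N, a n ^ 2 + (∑ n ∈ Finset.range N, b n ^ 2) / (1 - q) := by
    rw [Finset.mul_sum, Finset.sum_div, ← Finset.sum_add_distrib]
    exact Finset.sum_le_sum fun n _ => by rw [add_comm T n]; exact hstep n
  have h3 : (∑ n ∈ Finset.range N, b n ^ 2) / (1 - q) ≤ (∑' n, b n ^ 2) / (1 - q) :=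
    div_le_div_of_nonneg_right (hbs.sum_le_tsum _ (fun _ _ => sq_nonneg _)) hq.le
  linarith

/-- If `∑ α a²` converges, `∑ α` diverges and `a` varies at most like the partial sums of `α`,
up to a vanishing error, then `a` tends to zero. -/
theorem tendsto_zero_of_summable_mul_sq {a α e : ℕ → ℝ} {C : ℝ} (hC : 0 < C)
    (ha : ∀ n, 0 ≤ a n) (hα : ∀ n, 0 ≤ α n) (hdiv : ¬ Summable α)
    (hsum : Summable fun n => α n * a n ^ 2) (he : Tendsto e atTop (nhds 0))
    (hvar : ∀ n k, a n - a (n + k)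
      ≤ C * (∑ l ∈ Finset.range k, α (n + l)) + e n + e (n + k)) :
    Tendsto a atTop (nhds 0) := by
  refine tendsto_order.2 ⟨fun b hb => Eventually.of_forall fun n => hb.trans_le (ha n),
    fun b hb => ?_⟩
  by_contra hfreq
  set ε := b / 2 with hε
  have hεpos : 0 < ε := by positivity
  have hev : ∀ᶠ n in atTop, e n < ε / 4 := he.eventually_lt_const (by positivity)
  have htail : ∀ᶠ n in atTop, ∑' l, α (l + n) * a (l + n) ^ 2 < ε ^ 3 / (2 * C) :=
    (tendsto_sum_nat_add fun n => α n * a n ^ 2).eventually_lt_const (by positivity)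
  obtain ⟨N, hN⟩ := eventually_atTop.1 (hev.and htail)
  obtain ⟨n, hn, hNn⟩ := ((not_eventually.1 hfreq).and_eventually (eventually_ge_atTop N)).exists
  have han : 2 * ε ≤ a n := by rw [hε]; linarith [not_lt.1 hn]
  have hshift : Summable fun l => α (l + n) * a (l + n) ^ 2 :=
    (summable_nat_add_iff (f := fun n => α n * a n ^ 2) n).2 hsum
  have key : ∀ k, (∀ l < k, ε ≤ a (n + l)) →
      ∑ l ∈ Finset.range k, α (n + l) ≤ ε / (2 * C) := by
    intro k hk
    have h1 : ∑ l ∈ Finset.range k, α (n + l) * ε ^ 2 ≤ ε ^ 3 / (2 * C) := by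
      refine le_trans (Finset.sum_le_sum fun l hl => ?_)
        ((hshift.sum_le_tsum (Finset.range k)
          (fun l _ => mul_nonneg (hα _) (sq_nonneg _))).trans (hN n hNn).2.le)
      rw [add_comm l n]
      exact mul_le_mul_of_nonneg_left
        (pow_le_pow_left₀ hεpos.le (hk l (Finset.mem_range.1 hl)) 2) (hα _)
    rw [← Finset.sum_mul] at h1
    have h2 : ε ^ 3 / (2 * C) = ε / (2 * C) * ε ^ 2 := by ring
    rw [h2] at h1
    exact le_of_mul_le_mul_right h1 (by positivity)
  have hall : ∀ k, ε ≤ a (n + k) := by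
    intro k
    induction k using Nat.strong_induction_on with
    | _ k ih =>
      have h1 := mul_le_mul_of_nonneg_left (key k ih) hC.le
      have h2 : C * (ε / (2 * C)) = ε / 2 := by field_simp
      have := hvar n k
      have := (hN n hNn).1
      have := (hN (n + k) (by omega)).1
      linarith
  refine hdiv ((summable_nat_add_iff n).1 ?_)
  refine summable_of_sum_range_le (c := ε / (2 * C)) (fun l => hα _) fun k => ?_
  simpa only [add_comm] using key k fun l _ => hall l

end RealSequences

section Spread

variable {ι E : Type*} [NormedAddCommGroup E]

/-- Diameter of a finite family of points. -/
noncomputable def spread (u : ι → E) : ℝ := Metric.diam (Set.range u)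

theorem spread_nonneg (u : ι → E) : 0 ≤ spread u := Metric.diam_nonneg

theorem norm_sub_le_spread [Finite ι] (u : ι → E) (i j : ι) : ‖u i - u j‖ ≤ spread u := by
  rw [← dist_eq_norm]
  exact Metric.dist_le_diam_of_mem (Set.finite_range u).isBounded ⟨i, rfl⟩ ⟨j, rfl⟩

theorem spread_le {u : ι → E} {D : ℝ} (hD : 0 ≤ D) (h : ∀ i j, ‖u i - u j‖ ≤ D) :
    spread u ≤ D := by
  refine Metric.diam_le_of_forall_dist_le hD ?_
  rintro _ ⟨i, rfl⟩ _ ⟨j, rfl⟩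
  rw [dist_eq_norm]
  exact h i j

end Spread

section Consensus

variable {ι E : Type*} [Fintype ι] [NormedAddCommGroup E] [NormedSpace ℝ E]

/-- Transition matrix of the linear iteration with weights `W`, from time `n` to time `n + s`. -/
noncomputable def transitionMatrix [DecidableEq ι] (W : ℕ → Matrix ι ι ℝ) (n : ℕ) :
    ℕ → Matrix ι ι ℝ
  | 0 => 1
  | s + 1 => W (n + s) * transitionMatrix W n s

theorem transitionMatrix_nonneg [DecidableEq ι] {W : ℕ → Matrix ι ι ℝ} (hW : ∀ n i j, 0 ≤ W n i j)
    (n s : ℕ) (i j : ι) : 0 ≤ transitionMatrix W n s i j := by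
  induction s generalizing i with
  | zero =>
    simp only [transitionMatrix, Matrix.one_apply]
    split_ifs <;> norm_num
  | succ s ih =>
    simp only [transitionMatrix, Matrix.mul_apply]
    exact Finset.sum_nonneg fun k _ => mul_nonneg (hW _ _ _) (ih k)

theorem transitionMatrix_row_sum [DecidableEq ι] {W : ℕ → Matrix ι ι ℝ}
    (hW : ∀ n i, ∑ j, W n i j = 1)
    (n s : ℕ) (i : ι) : ∑ j, transitionMatrix W n s i j = 1 := by
  induction s generalizing i with
  | zero => simp [transitionMatrix, Matrix.one_apply]
  | succ s ih =>
    simp only [transitionMatrix, Matrix.mul_apply]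
    rw [Finset.sum_comm]
    simp [← Finset.mul_sum, ih, hW]

/-- One step of the iteration propagates lower bounds along edges of the communication graph. -/
theorem transitionMatrix_step [DecidableEq ι] {W : ℕ → Matrix ι ι ℝ} {θ : ℝ} (hθ : 0 ≤ θ)
    (hW : ∀ n i j, 0 ≤ W n i j) {n s : ℕ} {u v j : ι} (huv : θ ≤ W (n + s) v u)
    (h : θ ^ s ≤ transitionMatrix W n s u j) :
    θ ^ (s + 1) ≤ transitionMatrix W n (s + 1) v j := by
  simp only [transitionMatrix, Matrix.mul_apply]
  calc θ ^ (s + 1) = θ * θ ^ s := by ring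
    _ ≤ W (n + s) v u * transitionMatrix W n s u j := by gcongr; exact hW _ _ _
    _ ≤ _ := Finset.single_le_sum
      (f := fun k => W (n + s) v k * transitionMatrix W n s k j)
      (fun k _ => mul_nonneg (hW _ _ _) (transitionMatrix_nonneg hW _ _ _ _)) (Finset.mem_univ u)

theorem transitionMatrix_diag_step [DecidableEq ι] {W : ℕ → Matrix ι ι ℝ} {θ : ℝ} (hθ : 0 ≤ θ)
    (hW : ∀ n i j, 0 ≤ W n i j) (hdiag : ∀ n i, θ ≤ W n i i) {n s : ℕ} {u j : ι}
    (h : θ ^ s ≤ transitionMatrix W n s u j) (t : ℕ) :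
    θ ^ (s + t) ≤ transitionMatrix W n (s + t) u j := by
  induction t with
  | zero => exact h
  | succ t ih => exact transitionMatrix_step hθ hW (hdiag _ _) ih

/-- Under uniform strong connectivity over windows of length `B`, all entries of the transition
matrix over `card ι` windows are bounded below. -/
theorem transitionMatrix_lower_bound [DecidableEq ι] {W : ℕ → Matrix ι ι ℝ} {θ : ℝ} (hθ : 0 < θ)
    (hentries : ∀ n i j, W n i j = 0 ∨ θ ≤ W n i j) (hdiag : ∀ n i, θ ≤ W n i i) {B : ℕ}
    (hconn : ∀ n, ∀ a b : ι, Relation.ReflTransGen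
      (fun u v : ι => ∃ k ∈ Finset.Ico n (n + B), 0 < W k v u) a b) (n : ℕ) (i j : ι) :
    θ ^ (Fintype.card ι * B) ≤ transitionMatrix W n (Fintype.card ι * B) i j := by
  have hW : ∀ n i j, 0 ≤ W n i j := fun n i j =>
    (hentries n i j).elim (fun h => h.ge) fun h => hθ.le.trans h
  set S : ℕ → Finset ι := fun r =>
    Finset.univ.filter fun i => θ ^ (r * B) ≤ transitionMatrix W n (r * B) i j with hS
  have hmono : ∀ r, S r ⊆ S (r + 1) := by
    intro r u hu
    simp only [hS, Finset.mem_filter, Finset.mem_univ, true_and] at hu ⊢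
    rw [add_mul, one_mul]
    exact transitionMatrix_diag_step hθ.le hW hdiag hu B
  have hj : ∀ r, j ∈ S r := by
    intro r
    induction r with
    | zero => simp [hS, transitionMatrix]
    | succ r ih => exact hmono r ih
  have hgrow : ∀ r, r ≤ (S r).card ∨ S r = Finset.univ := by
    intro r
    induction r with
    | zero => exact Or.inl (Nat.zero_le _)
    | succ r ih =>
      by_cases hu : S r = Finset.univ
      · exact Or.inr (Finset.univ_subset_iff.1 (hu ▸ hmono r))
      · have hcard := ih.resolve_right hu
        left
        obtain ⟨b, hb⟩ : ∃ b, b ∉ S r := by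
          by_contra! hall
          exact hu (Finset.eq_univ_iff_forall.2 hall)
        obtain ⟨u, v, huS, hvS, k, hk, hpos⟩ : ∃ u v, u ∈ S r ∧ v ∉ S r ∧
            ∃ k ∈ Finset.Ico (n + r * B) (n + r * B + B), 0 < W k v u := by
          by_contra! hno
          refine hb (Relation.ReflTransGen.head_induction_on (motive := fun a _ => a ∈ S r → b ∈ S r)
            (hconn (n + r * B) j b) (fun h => h) ?_ (hj r))
          rintro a c ⟨k, hk, hpos⟩ - ih ha
          refine ih ?_
          by_contra hc
          exact absurd hpos (not_lt.2 (hno a c ha hc k hk))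
        refine lt_of_le_of_lt hcard (Finset.card_lt_card
          (Finset.ssubset_iff_of_subset (hmono r) |>.2 ⟨v, ?_, hvS⟩))
        simp only [hS, Finset.mem_filter, Finset.mem_univ, true_and] at huS ⊢
        obtain ⟨hk1, hk2⟩ := Finset.mem_Ico.1 hk
        obtain ⟨t, rfl⟩ := Nat.exists_eq_add_of_le hk1
        have h1 := transitionMatrix_diag_step hθ.le hW hdiag huS t
        have h2 : θ ^ (r * B + t + 1) ≤ transitionMatrix W n (r * B + t + 1) v j :=
          transitionMatrix_step hθ.le hW (u := u)
            (by rw [← add_assoc]; exact (hentries _ _ _).resolve_left hpos.ne') h1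
        have h3 := transitionMatrix_diag_step hθ.le hW hdiag h2 (B - (t + 1))
        have h4 : r * B + t + 1 + (B - (t + 1)) = (r + 1) * B := by
          rw [add_mul, one_mul]; omega
        rwa [h4] at h3
  have huniv : S (Fintype.card ι) = Finset.univ :=
    (hgrow _).elim (fun h => Finset.card_eq_iff_eq_univ _ |>.1
      (le_antisymm (Finset.card_le_univ _) h)) id
  have := Finset.mem_univ i
  rw [← huniv] at this
  simpa [hS] using this

/-- Averaging with two weight vectors sharing mass `η²` at an index contracts distances. -/
theorem norm_sum_smul_sub_sum_smul_le {p r : ι → ℝ} (hp : ∀ k, 0 ≤ p k) (hr : ∀ k, 0 ≤ r k)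
    (hp1 : ∑ k, p k = 1) (hr1 : ∑ k, r k = 1) {η : ℝ} (hη : 0 ≤ η) {k₀ : ι} (hpk : η ≤ p k₀)
    (hrk : η ≤ r k₀) {u : ι → E} {D : ℝ} (hD : ∀ k l, ‖u k - u l‖ ≤ D) :
    ‖∑ k, p k • u k - ∑ k, r k • u k‖ ≤ (1 - η ^ 2) * D := by
  classical
  have hD0 : 0 ≤ D := (norm_nonneg _).trans (hD k₀ k₀)
  have h1 : ∑ k, p k • u k - ∑ k, r k • u k = ∑ k, ∑ l, (p k * r l) • (u k - u l) := by
    have ha : ∑ k, ∑ l, (p k * r l) • u k = ∑ k, p k • u k :=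
      Finset.sum_congr rfl fun k _ => by rw [← Finset.sum_smul, ← Finset.mul_sum, hr1, mul_one]
    have hb : ∑ k, ∑ l, (p k * r l) • u l = ∑ l, r l • u l := by
      rw [Finset.sum_comm]
      exact Finset.sum_congr rfl fun l _ => by
        rw [← Finset.sum_smul, ← Finset.sum_mul, hp1, one_mul]
    simp only [smul_sub, Finset.sum_sub_distrib, ha, hb]
  have h2 : ∀ k l, ‖(p k * r l) • (u k - u l)‖
      ≤ p k * r l * D - if k = k₀ ∧ l = k₀ then η ^ 2 * D else 0 := by
    intro k l
    rw [norm_smul, Real.norm_of_nonneg (mul_nonneg (hp k) (hr l))]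
    split_ifs with h
    · rw [h.1, h.2]
      have : η ^ 2 ≤ p k₀ * r k₀ := by rw [sq]; exact mul_le_mul hpk hrk hη (hp k₀)
      simp only [sub_self, norm_zero, mul_zero]
      nlinarith
    · rw [sub_zero]
      exact mul_le_mul_of_nonneg_left (hD k l) (mul_nonneg (hp k) (hr l))
  have h3 : ∑ k, ∑ l, p k * r l * D = D := by
    simp only [← Finset.sum_mul, ← Finset.mul_sum, hr1, hp1, mul_one, one_mul]
  have h4 : ∑ k, ∑ l, (if k = k₀ ∧ l = k₀ then η ^ 2 * D else 0) = η ^ 2 * D := by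
    simp [ite_and]
  rw [h1]
  calc _ ≤ ∑ k, ∑ l, (p k * r l * D - if k = k₀ ∧ l = k₀ then η ^ 2 * D else 0) :=
        (norm_sum_le _ _).trans (Finset.sum_le_sum fun k _ =>
          (norm_sum_le _ _).trans (Finset.sum_le_sum fun l _ => h2 k l))
    _ = _ := by simp only [Finset.sum_sub_distrib, h3, h4]; ring

/-- A perturbed weighted-averaging iteration stays close to the unperturbed one. -/
theorem norm_sub_transitionMatrix_sum_le [DecidableEq ι] {W : ℕ → Matrix ι ι ℝ}
    (hW : ∀ n i j, 0 ≤ W n i j) (hrow : ∀ n i, ∑ j, W n i j = 1) {v δ : ι → ℕ → E}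
    (hv : ∀ i n, v i (n + 1) = ∑ j, W n i j • v j n + δ i n) (n s : ℕ) (i : ι) :
    ‖v i (n + s) - ∑ j, transitionMatrix W n s i j • v j n‖
      ≤ ∑ l ∈ Finset.range s, ∑ k, ‖δ k (n + l)‖ := by
  induction s generalizing i with
  | zero => simp [transitionMatrix, Matrix.one_apply, ite_smul]
  | succ s ih =>
    rw [Finset.sum_range_succ, ← add_assoc, hv]
    have h1 : ∑ j, transitionMatrix W n (s + 1) i j • v j n
        = ∑ k, W (n + s) i k • ∑ j, transitionMatrix W n s k j • v j n := by
      simp only [transitionMatrix, Matrix.mul_apply, Finset.sum_smul, Finset.smul_sum, smul_smul]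
      rw [Finset.sum_comm]
    have h2 : ∑ j, W (n + s) i j • v j (n + s) + δ i (n + s)
          - ∑ j, transitionMatrix W n (s + 1) i j • v j n
        = ∑ k, W (n + s) i k • (v k (n + s) - ∑ j, transitionMatrix W n s k j • v j n)
          + δ i (n + s) := by
      rw [h1]; simp only [smul_sub, Finset.sum_sub_distrib]; abel
    rw [h2]
    refine (norm_add_le _ _).trans (add_le_add ?_ (Finset.single_le_sum
      (f := fun k => ‖δ k (n + s)‖) (fun _ _ => norm_nonneg _) (Finset.mem_univ i)))
    calc _ ≤ ∑ k, W (n + s) i k * ∑ l ∈ Finset.range s, ∑ k, ‖δ k (n + l)‖ := by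
          refine (norm_sum_le _ _).trans (Finset.sum_le_sum fun k _ => ?_)
          rw [norm_smul, Real.norm_of_nonneg (hW _ _ _)]
          exact mul_le_mul_of_nonneg_left (ih k) (hW _ _ _)
      _ = _ := by rw [← Finset.sum_mul, hrow, one_mul]

theorem norm_sub_mean_le_spread [Nonempty ι] (u : ι → E) (i : ι) :
    ‖u i - (Fintype.card ι : ℝ)⁻¹ • ∑ j, u j‖ ≤ spread u := by
  have hc : (0 : ℝ) < Fintype.card ι := by exact_mod_cast Fintype.card_pos
  have h1 : u i - (Fintype.card ι : ℝ)⁻¹ • ∑ j, u j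
      = (Fintype.card ι : ℝ)⁻¹ • ∑ j, (u i - u j) := by
    rw [Finset.sum_sub_distrib, smul_sub, Finset.sum_const, Finset.card_univ,
      ← Nat.cast_smul_eq_nsmul ℝ, smul_smul, inv_mul_cancel₀ hc.ne', one_smul]
  rw [h1, norm_smul, Real.norm_of_nonneg (inv_nonneg.2 hc.le), inv_mul_le_iff₀ hc]
  calc _ ≤ ∑ _j : ι, spread u :=
        (norm_sum_le _ _).trans (Finset.sum_le_sum fun j _ => norm_sub_le_spread u i j)
    _ = _ := by simp

/-- The spread of a perturbed consensus iteration contracts over a fixed time horizon. -/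
theorem exists_spread_contraction [Nonempty ι] {W : ℕ → Matrix ι ι ℝ} {θ : ℝ} (hθ : 0 < θ)
    (hθ1 : θ < 1) (hentries : ∀ n i j, W n i j = 0 ∨ θ ≤ W n i j) (hdiag : ∀ n i, θ ≤ W n i i)
    (hrow : ∀ n i, ∑ j, W n i j = 1) {B : ℕ} (hB : 0 < B)
    (hconn : ∀ n, ∀ a b : ι, Relation.ReflTransGen
      (fun u v : ι => ∃ k ∈ Finset.Ico n (n + B), 0 < W k v u) a b) :
    ∃ T : ℕ, 0 < T ∧ ∃ q : ℝ, 0 ≤ q ∧ q < 1 ∧ ∀ v δ : ι → ℕ → E,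
      (∀ i n, v i (n + 1) = ∑ j, W n i j • v j n + δ i n) → ∀ n,
      spread (fun i => v i (n + T))
        ≤ q * spread (fun i => v i n) + 2 * ∑ l ∈ Finset.range T, ∑ k, ‖δ k (n + l)‖ := by
  classical
  have hW : ∀ n i j, 0 ≤ W n i j := fun n i j =>
    (hentries n i j).elim (fun h => h.ge) fun h => hθ.le.trans h
  have hη : 0 < θ ^ (Fintype.card ι * B) := by positivity
  have hη1 : θ ^ (Fintype.card ι * B) ≤ 1 := pow_le_one₀ hθ.le hθ1.le
  have hq0 : 0 ≤ 1 - (θ ^ (Fintype.card ι * B)) ^ 2 :=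
    sub_nonneg.2 (pow_le_one₀ hη.le hη1)
  refine ⟨Fintype.card ι * B, Nat.mul_pos Fintype.card_pos hB,
    1 - (θ ^ (Fintype.card ι * B)) ^ 2, hq0,
    sub_lt_self _ (by positivity), fun v δ hv n => ?_⟩
  have hsn : 0 ≤ ∑ l ∈ Finset.range (Fintype.card ι * B), ∑ k, ‖δ k (n + l)‖ :=
    Finset.sum_nonneg fun _ _ => Finset.sum_nonneg fun _ _ => norm_nonneg _
  refine spread_le (add_nonneg (mul_nonneg hq0 (spread_nonneg _)) (by positivity)) fun i j => ?_
  have h1 := norm_sub_transitionMatrix_sum_le hW hrow hv n (Fintype.card ι * B) i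
  have h2 := norm_sub_transitionMatrix_sum_le hW hrow hv n (Fintype.card ι * B) j
  have h3 := norm_sum_smul_sub_sum_smul_le (u := fun i => v i n)
    (transitionMatrix_nonneg hW n (Fintype.card ι * B) i)
    (transitionMatrix_nonneg hW n (Fintype.card ι * B) j)
    (transitionMatrix_row_sum hrow n _ i) (transitionMatrix_row_sum hrow n _ j) hη.le
    (transitionMatrix_lower_bound hθ hentries hdiag hconn n i i)
    (transitionMatrix_lower_bound hθ hentries hdiag hconn n j i)
    (norm_sub_le_spread fun i => v i n)
  rw [norm_sub_rev] at h2
  have h4 := norm_add₃_le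
    (a := v i (n + Fintype.card ι * B)
      - ∑ k, transitionMatrix W n (Fintype.card ι * B) i k • v k n)
    (b := ∑ k, transitionMatrix W n (Fintype.card ι * B) i k • v k n
      - ∑ k, transitionMatrix W n (Fintype.card ι * B) j k • v k n)
    (c := ∑ k, transitionMatrix W n (Fintype.card ι * B) j k • v k n
      - v j (n + Fintype.card ι * B))
  rw [sub_add_sub_cancel, sub_add_sub_cancel] at h4
  linarith

end Consensus

section ConvexAnalysis

variable {E : Type*} [NormedAddCommGroup E] [InnerProductSpace ℝ E]

/-- Optimality condition for `⟪c, ·⟫ + G` over a convex set, with an explicit subgradient of the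
continuous convex function `G`. -/
theorem exists_subgradient_of_variational [CompleteSpace E] {G : E → ℝ}
    (hG : ConvexOn ℝ Set.univ G) (hGc : Continuous G) {K : Set E} (hK : Convex ℝ K) {p c : E}
    (hp : p ∈ K) (h : ∀ u ∈ K, 0 ≤ ⟪c, u - p⟫_ℝ + G u - G p) :
    ∃ g, (∀ y, G p + ⟪g, y - p⟫_ℝ ≤ G y) ∧ ∀ u ∈ K, 0 ≤ ⟪c + g, u - p⟫_ℝ := by
  have hs : Convex ℝ {q : E × ℝ | q.1 ∈ Set.univ ∧ G q.1 < q.2} := hG.convex_strict_epigraph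
  have hso : IsOpen {q : E × ℝ | q.1 ∈ Set.univ ∧ G q.1 < q.2} := by
    simp only [Set.mem_univ, true_and]
    exact isOpen_lt (hGc.comp continuous_fst) continuous_snd
  have ht : Convex ℝ {q : E × ℝ | q.1 ∈ K ∧ q.2 ≤ G p - ⟪c, q.1 - p⟫_ℝ} := by
    have : ConcaveOn ℝ K fun u => G p - ⟪c, u - p⟫_ℝ := by
      refine ⟨hK, fun x _ y _ a b _ _ hab => le_of_eq ?_⟩
      simp only [smul_eq_mul, inner_sub_right, inner_add_right, inner_smul_right]
      linear_combination (G p + ⟪c, p⟫_ℝ) * hab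
    exact this.convex_hypograph
  obtain ⟨φ, r, hφs, hφt⟩ := geometric_hahn_banach_open hs hso ht (by
    rw [Set.disjoint_left]
    rintro ⟨u, t⟩ ⟨-, h1⟩ ⟨hu, h2⟩
    have := h u hu
    simp only at h1 h2
    linarith)
  set l : ℝ := φ (0, 1) with hl
  set ψ : StrongDual ℝ E := φ.comp (ContinuousLinearMap.inl ℝ E ℝ) with hψ
  have hsplit : ∀ u t, φ (u, t) = ψ u + t * l := by
    intro u t
    have : ((u, t) : E × ℝ) = (u, 0) + t • ((0, 1) : E × ℝ) := by simp
    rw [this, map_add, map_smul, smul_eq_mul]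
    rfl
  have h1 : ∀ u t, G u < t → ψ u + t * l < r := fun u t hut => by
    rw [← hsplit]; exact hφs (u, t) ⟨Set.mem_univ _, hut⟩
  have h2 : ∀ u ∈ K, r ≤ ψ u + (G p - ⟪c, u - p⟫_ℝ) * l := fun u hu => by
    rw [← hsplit]; exact hφt (u, _) ⟨hu, le_rfl⟩
  have h2p : r ≤ ψ p + G p * l := by simpa using h2 p hp
  have hlneg : l < 0 := by
    have := h1 p (G p + 1) (by linarith)
    linarith
  have h1' : ∀ u, ψ u + G u * l ≤ r := by
    intro u
    refine le_of_forall_pos_le_add fun ε hε => ?_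
    have := h1 u (G u + ε / (-l)) (by have : 0 < ε / (-l) := div_pos hε (by linarith)
                                      linarith)
    have h3 : ε / (-l) * l = -ε := by
      rw [div_neg, neg_mul, div_mul_cancel₀ _ hlneg.ne]
    linarith
  refine ⟨(InnerProductSpace.toDual ℝ E).symm ((-l)⁻¹ • ψ), fun y => ?_, fun u hu => ?_⟩
  · rw [InnerProductSpace.toDual_symm_apply]
    simp only [smul_apply, map_sub, smul_eq_mul]
    have h3 : (-l)⁻¹ * (ψ y - ψ p) ≤ G y - G p := by
      rw [inv_mul_le_iff₀ (by linarith)]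
      nlinarith [h1' y]
    linarith
  · rw [inner_add_left, InnerProductSpace.toDual_symm_apply]
    simp only [smul_apply, map_sub, smul_eq_mul]
    have h3 : -⟪c, u - p⟫_ℝ ≤ (-l)⁻¹ * (ψ u - ψ p) := by
      rw [le_inv_mul_iff₀ (by linarith)]
      nlinarith [h2 u hu, h1' p]
    linarith

/-- A function on the line that is minimal at `0` among `[0, 1]` has nonnegative derivative. -/
theorem deriv_nonneg_of_min_Icc {h : ℝ → ℝ} {h' : ℝ} (hd : HasDerivAt h h' 0)
    (hmin : ∀ t ∈ Set.Icc (0 : ℝ) 1, h 0 ≤ h t) : 0 ≤ h' := by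
  have h1 : IsLocalMinOn h (Set.Icc 0 1) 0 := by
    filter_upwards [self_mem_nhdsWithin] with t ht using hmin t ht
  have h2 := h1.hasFDerivWithinAt_nonneg hd.hasFDerivAt.hasFDerivWithinAt (y := 1)
    (mem_posTangentConeAt_of_segment_subset (by simp [segment_eq_Icc]))
  simpa using h2

theorem HasGradientAt.hasDerivAt_line [CompleteSpace E] {φ : E → ℝ} {g x : E}
    (h : HasGradientAt φ g x) (d : E) :
    HasDerivAt (fun t : ℝ => φ (x + t • d)) ⟪g, d⟫_ℝ 0 := by
  have h1 : HasDerivAt (fun t : ℝ => x + t • d) d 0 := by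
    simpa using ((hasDerivAt_id (0 : ℝ)).smul_const d).const_add x
  have h2 : HasFDerivAt φ (InnerProductSpace.toDual ℝ E g) (x + (0 : ℝ) • d) := by
    simpa using h.hasFDerivAt
  exact (h2.comp_hasDerivAt (0 : ℝ) h1).congr_deriv (InnerProductSpace.toDual_apply_apply ..)

/-- Variational inequality satisfied by a minimizer of a smooth plus a convex function. -/
theorem variational_of_isMinOn_add_convex [CompleteSpace E] {K : Set E} (hK : Convex ℝ K)
    {φ G : E → ℝ} (hG : ConvexOn ℝ Set.univ G) {g p : E} (hp : p ∈ K) (hφ : HasGradientAt φ g p)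
    (hmin : ∀ u ∈ K, φ p + G p ≤ φ u + G u) {u : E} (hu : u ∈ K) :
    0 ≤ ⟪g, u - p⟫_ℝ + G u - G p := by
  have hd : HasDerivAt (fun t : ℝ => φ (p + t • (u - p)) + t * (G u - G p))
      (⟪g, u - p⟫_ℝ + (G u - G p)) 0 := by
    exact ((hφ.hasDerivAt_line (u - p)).add
      ((hasDerivAt_id (0 : ℝ)).mul_const (G u - G p))).congr_deriv (by rw [one_mul])
  have := deriv_nonneg_of_min_Icc hd fun t ht => by
    have h1 := hmin _ (hK.add_smul_sub_mem hp hu ht)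
    have h2 := hG.2 (Set.mem_univ p) (Set.mem_univ u) (sub_nonneg.2 ht.2) ht.1 (by ring)
    have h3 : (1 - t) • p + t • u = p + t • (u - p) := by module
    rw [h3] at h2
    simp only [smul_eq_mul] at h2
    simp only [zero_smul, add_zero, zero_mul]
    linarith
  linarith

/-- First-order lower bound for a strongly convex function. -/
theorem StrongConvexOn.add_inner_le [CompleteSpace E] {K : Set E} {τ : ℝ} {φ : E → ℝ}
    (hφ : StrongConvexOn K τ φ) {x y g : E} (hx : x ∈ K) (hy : y ∈ K) (hg : HasGradientAt φ g x) :
    φ x + ⟪g, y - x⟫_ℝ + τ / 2 * ‖y - x‖ ^ 2 ≤ φ y := by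
  set c := τ / 2 * ‖y - x‖ ^ 2 with hc
  have hd : HasDerivAt (fun t : ℝ => (1 - t) * φ x + t * φ y - t * (1 - t) * c
      - φ (x + t • (y - x))) (φ y - φ x - c - ⟪g, y - x⟫_ℝ) 0 := by
    have h0 := hasDerivAt_id (0 : ℝ)
    have h1 := h0.const_sub 1
    refine ((((h1.mul_const (φ x)).add (h0.mul_const (φ y))).sub ((h0.mul h1).mul_const c)).sub
      (hg.hasDerivAt_line (y - x))).congr_deriv ?_
    simp only [id]
    ring
  have := deriv_nonneg_of_min_Icc hd fun t ht => by
    have h2 := hφ.2 hx hy (sub_nonneg.2 ht.2) ht.1 (by ring)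
    have h3 : (1 - t) • x + t • y = x + t • (y - x) := by module
    simp only [h3, norm_sub_rev x y, ← hc, smul_eq_mul] at h2
    simp only [zero_smul, add_zero]
    linarith
  linarith

theorem StrongConvexOn.inner_sub_le [CompleteSpace E] {K : Set E} {τ : ℝ} {φ : E → ℝ}
    (hφ : StrongConvexOn K τ φ) {x y g g' : E} (hx : x ∈ K) (hy : y ∈ K)
    (hg : HasGradientAt φ g x) (hg' : HasGradientAt φ g' y) :
    τ * ‖y - x‖ ^ 2 ≤ ⟪g' - g, y - x⟫_ℝ := by
  have h1 := hφ.add_inner_le hx hy hg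
  have h2 := hφ.add_inner_le hy hx hg'
  rw [norm_sub_rev x y, ← neg_sub y x, inner_neg_right] at h2
  rw [inner_sub_left]
  linarith

/-- Descent inequality for a function with Lipschitz gradient on a convex set. -/
theorem le_add_inner_add_sq_of_lipschitz_gradient [CompleteSpace E] {K : Set E}
    (hK : Convex ℝ K) {φ : E → ℝ} {g : E → E} (hg : ∀ x ∈ K, HasGradientAt φ (g x) x) {L : ℝ}
    (hL0 : 0 ≤ L) (hL : ∀ x ∈ K, ∀ y ∈ K, ‖g x - g y‖ ≤ L * ‖x - y‖) {x y : E} (hx : x ∈ K)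
    (hy : y ∈ K) : φ y ≤ φ x + ⟪g x, y - x⟫_ℝ + L * ‖y - x‖ ^ 2 := by
  obtain ⟨z, hz, hzeq⟩ := domain_mvt
    (fun u hu => (hg u hu).hasFDerivAt.hasFDerivWithinAt) hK hx hy
  rw [InnerProductSpace.toDual_apply_apply] at hzeq
  have hzK : z ∈ K := hK.segment_subset hx hy hz
  have h1 : ‖z - x‖ ≤ ‖y - x‖ :=
    norm_sub_le_of_mem_segment hz
  have h2 : ⟪g z - g x, y - x⟫_ℝ ≤ L * ‖y - x‖ ^ 2 := by
    calc _ ≤ ‖g z - g x‖ * ‖y - x‖ := real_inner_le_norm _ _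
      _ ≤ L * ‖y - x‖ * ‖y - x‖ := by
        gcongr
        exact (hL z hzK x hx).trans (mul_le_mul_of_nonneg_left h1 hL0)
      _ = _ := by ring
  rw [inner_sub_left] at h2
  linarith

/-- A convex function whose subgradients on `K` are bounded by `LG` is `LG`-Lipschitz on `K`. -/
theorem sub_le_of_subgradient_bound [CompleteSpace E] {G : E → ℝ}
    (hG : ConvexOn ℝ Set.univ G) (hGc : Continuous G) {K : Set E} {LG : ℝ}
    (hsub : ∀ x ∈ K, ∀ g, (∀ y, G x + ⟪g, y - x⟫_ℝ ≤ G y) → ‖g‖ ≤ LG) {x : E} (hx : x ∈ K)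
    (y : E) : G x - G y ≤ LG * ‖x - y‖ := by
  obtain ⟨g, hg, -⟩ := exists_subgradient_of_variational hG hGc (convex_singleton x) (c := 0)
    (Set.mem_singleton x) (by simp)
  have h1 := hg y
  have h2 : ⟪g, x - y⟫_ℝ ≤ LG * ‖x - y‖ :=
    (real_inner_le_norm _ _).trans (mul_le_mul_of_nonneg_right (hsub x hx g hg) (norm_nonneg _))
  rw [← neg_sub y x, inner_neg_right, neg_sub] at h2
  linarith

/-- Stability of the solutions of strongly monotone variational inequalities with respect to the
data: `a` and `b` are the operators of the two problems at their solutions `p` and `p'`, and `b'`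
is the second operator at `p`. -/
theorem mul_norm_sub_le_of_variational {τ : ℝ} {p p' a b b' c c' : E} {s : ℝ}
    (h : 0 ≤ ⟪a + c, p' - p⟫_ℝ + s) (h' : 0 ≤ ⟪b + c', p - p'⟫_ℝ - s)
    (hmono : τ * ‖p' - p‖ ^ 2 ≤ ⟪b - b', p' - p⟫_ℝ) :
    τ * ‖p' - p‖ ≤ ‖b' - a‖ + ‖c' - c‖ := by
  rcases (norm_nonneg (p' - p)).eq_or_lt' with h0 | h0
  · rw [h0, mul_zero]; positivity
  refine le_of_mul_le_mul_right ?_ h0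
  have h1 : ⟪-(b' - a) - (c' - c), p' - p⟫_ℝ ≤ (‖b' - a‖ + ‖c' - c‖) * ‖p' - p‖ := by
    refine (real_inner_le_norm _ _).trans (mul_le_mul_of_nonneg_right ?_ h0.le)
    rw [← norm_neg (b' - a)]
    exact norm_sub_le _ _
  rw [← neg_sub p' p, inner_neg_right] at h'
  simp only [inner_sub_left, inner_add_left, inner_neg_left] at h h' hmono h1
  linarith

end ConvexAnalysis
/-- Convergence of the (exact) NEXT algorithm: the average sequence is bounded, every limit point is a stationary solution of `min_{x∈K} F + G`, and asymptotic consensus is achieved. -/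
theorem stmt_9 {m I : ℕ} (hI : 0 < I)
    (K : Set (EuclideanSpace ℝ (Fin m)))
    (hKne : K.Nonempty) (hKcl : IsClosed K) (hKcv : Convex ℝ K)
    (f : Fin I → EuclideanSpace ℝ (Fin m) → ℝ)
    (gf : Fin I → EuclideanSpace ℝ (Fin m) → EuclideanSpace ℝ (Fin m))
    (Uo : Set (EuclideanSpace ℝ (Fin m))) (hUo : IsOpen Uo) (hKUo : K ⊆ Uo)
    (hdiff : ∀ i, ∀ x ∈ Uo, HasGradientAt (f i) (gf i x) x)
    (hgradcont : ∀ i, ContinuousOn (gf i) Uo)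
    (L : Fin I → ℝ)
    (hLip : ∀ i, ∀ x ∈ K, ∀ y ∈ K, ‖gf i x - gf i y‖ ≤ L i * ‖x - y‖)
    (LF : ℝ) (hLF : 0 < LF)
    (hgb : ∀ i, ∀ x ∈ K, ‖gf i x‖ ≤ LF)
    (G : EuclideanSpace ℝ (Fin m) → ℝ) (hG : ConvexOn ℝ Set.univ G)
    (LG : ℝ)
    (hsub : ∀ x ∈ K, ∀ g, (∀ y, G x + ⟪g, y - x⟫_ℝ ≤ G y) → ‖g‖ ≤ LG)
    (hcoer : ∀ c : ℝ, ∃ r : ℝ, ∀ x ∈ K, r ≤ ‖x‖ → c ≤ (∑ i, f i x) + G x)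
    (ft : Fin I → EuclideanSpace ℝ (Fin m) → EuclideanSpace ℝ (Fin m) → ℝ)
    (gft : Fin I → EuclideanSpace ℝ (Fin m) → EuclideanSpace ℝ (Fin m) → EuclideanSpace ℝ (Fin m))
    (τ : Fin I → ℝ) (hτ : ∀ i, 0 < τ i)
    (hF1 : ∀ i, ∀ z ∈ K, StrongConvexOn K (τ i) (fun x => ft i x z))
    (hftgrad : ∀ i, ∀ z ∈ K, ∀ x ∈ K, HasGradientAt (fun u => ft i u z) (gft i x z) x)
    (hF2 : ∀ i, ∀ x ∈ K, gft i x x = gf i x)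
    (Lt : ℝ)
    (hF3 : ∀ i, ∀ x ∈ K, ∀ w ∈ K, ∀ z ∈ K, ‖gft i x w - gft i x z‖ ≤ Lt * ‖w - z‖)
    (θ : ℝ) (hθ : θ ∈ Set.Ioo (0 : ℝ) 1)
    (W : ℕ → Fin I → Fin I → ℝ)
    (hWentries : ∀ n i j, W n i j = 0 ∨ W n i j ∈ Set.Icc θ 1)
    (hWdiag : ∀ n i, θ ≤ W n i i)
    (hWrow : ∀ n i, ∑ j, W n i j = 1)
    (hWcol : ∀ n j, ∑ i, W n i j = 1)
    (B : ℕ) (hB : 0 < B)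
    (hconn : ∀ k : ℕ, ∀ a b : Fin I,
      Relation.ReflTransGen
        (fun u v : Fin I => ∃ n ∈ Finset.Ico (k * B) ((k + 1) * B), 0 < W n v u) a b)
    (α : ℕ → ℝ) (hα : ∀ n, α n ∈ Set.Ioc (0 : ℝ) 1)
    (hαdiv : ¬ Summable α)
    (hαsq : Summable (fun n => (α n) ^ 2))
    (x xt y πt : Fin I → ℕ → EuclideanSpace ℝ (Fin m))
    (hx0 : ∀ i, x i 0 ∈ K)
    (hy0 : ∀ i, y i 0 = gf i (x i 0))
    (hπt : ∀ i n, πt i n = (I : ℝ) • y i n - gf i (x i n))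
    (hxt : ∀ i n, xt i n ∈ K ∧ ∀ u ∈ K, u ≠ xt i n →
      ft i (xt i n) (x i n) + ⟪πt i n, xt i n - x i n⟫_ℝ + G (xt i n)
        < ft i u (x i n) + ⟪πt i n, u - x i n⟫_ℝ + G u)
    (hyrec : ∀ i n, y i (n + 1) = (∑ j, W n i j • y j n) + gf i (x i (n + 1)) - gf i (x i n))
    (hxrec : ∀ i n, x i (n + 1) = ∑ j, W n i j • (x j n + α n • (xt j n - x j n)))
    (xbar : ℕ → EuclideanSpace ℝ (Fin m)) (hxbar : ∀ n, xbar n = (I : ℝ)⁻¹ • ∑ j, x j n) :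
    ((∃ R : ℝ, ∀ n, ‖xbar n‖ ≤ R) ∧
      (∀ p, MapClusterPt p Filter.atTop xbar →
        p ∈ K ∧ ∃ g, (∀ y, G p + ⟪g, y - p⟫_ℝ ≤ G y) ∧
          ∀ y ∈ K, 0 ≤ ⟪(∑ j, gf j p) + g, y - p⟫_ℝ)) ∧
    (∀ i, Filter.Tendsto (fun n => ‖x i n - xbar n‖) Filter.atTop (nhds 0)) := by
  have : Nonempty (Fin I) := ⟨⟨0, hI⟩⟩
  have hIpos : (0 : ℝ) < I := Nat.cast_pos.2 hI
  have hWnn : ∀ n i j, 0 ≤ W n i j := fun n i j =>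
    (hWentries n i j).elim (fun h => h.ge) fun h => hθ.1.le.trans h.1
  -- Uniform Lipschitz constants
  obtain ⟨Lm, hLm0, hLm⟩ : ∃ Lm : ℝ, 0 ≤ Lm ∧
      ∀ i, ∀ x ∈ K, ∀ y ∈ K, ‖gf i x - gf i y‖ ≤ Lm * ‖x - y‖ := by
    refine ⟨∑ i, |L i|, Finset.sum_nonneg fun _ _ => abs_nonneg _, fun i x hx y hy =>
      (hLip i x hx y hy).trans (mul_le_mul_of_nonneg_right ?_ (norm_nonneg _))⟩
    exact (le_abs_self _).trans
      (Finset.single_le_sum (f := fun i => |L i|) (fun _ _ => abs_nonneg _) (Finset.mem_univ i))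
  have hGc : Continuous G := continuousOn_univ.1 (hG.continuousOn isOpen_univ)
  obtain ⟨LG', hLG0, hGlip⟩ : ∃ LG' : ℝ, 0 ≤ LG' ∧
      ∀ x ∈ K, ∀ y, G x - G y ≤ LG' * ‖x - y‖ :=
    ⟨|LG|, abs_nonneg _, fun x hx y => (sub_le_of_subgradient_bound hG hGc hsub hx y).trans
      (mul_le_mul_of_nonneg_right (le_abs_self _) (norm_nonneg _))⟩
  have hgrad : ∀ i, ∀ x ∈ K, HasGradientAt (f i) (gf i x) x := fun i x hx => hdiff i x (hKUo hx)
  -- Feasibility of the iterates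
  have hxK : ∀ n i, x i n ∈ K := by
    intro n
    induction n with
    | zero => exact hx0
    | succ n ih =>
      intro i
      rw [hxrec]
      exact hKcv.sum_mem (fun j _ => hWnn n i j) (hWrow n i) fun j _ =>
        hKcv.add_smul_sub_mem (ih j) (hxt j n).1 ⟨(hα n).1.le, (hα n).2⟩
  have hxtK : ∀ i n, xt i n ∈ K := fun i n => (hxt i n).1
  have hmeanK : ∀ v : Fin I → EuclideanSpace ℝ (Fin m), (∀ i, v i ∈ K) →
      (I : ℝ)⁻¹ • ∑ j, v j ∈ K := by
    intro v hv
    rw [Finset.smul_sum]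
    exact hKcv.sum_mem (fun _ _ => inv_nonneg.2 hIpos.le)
      (by simp [hIpos.ne']) fun j _ => hv j
  have hxbarK : ∀ n, xbar n ∈ K := fun n => by rw [hxbar]; exact hmeanK _ (hxK n)
  -- Optimality of the local best responses
  have hVI : ∀ i n, ∀ u ∈ K,
      0 ≤ ⟪gft i (xt i n) (x i n) + πt i n, u - xt i n⟫_ℝ + (G u - G (xt i n)) := by
    intro i n u hu
    have hφ : HasGradientAt (fun u => ft i u (x i n) + ⟪πt i n, u - x i n⟫_ℝ)
        (gft i (xt i n) (x i n) + πt i n) (xt i n) := by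
      have h1 := (hftgrad i (x i n) (hxK n i) (xt i n) (hxtK i n)).hasFDerivAt
      have h2 : HasFDerivAt (fun u => ⟪πt i n, u - x i n⟫_ℝ)
          (InnerProductSpace.toDual ℝ _ (πt i n)) (xt i n) :=
        (InnerProductSpace.toDual ℝ _ (πt i n)).hasFDerivAt.comp (xt i n)
          ((hasFDerivAt_id _).sub_const (x i n))
      rw [hasGradientAt_iff_hasFDerivAt, map_add]
      exact h1.add h2
    have := variational_of_isMinOn_add_convex hKcv hG (hxtK i n) hφ (fun u hu => by
      by_cases h : u = xt i n
      · rw [h]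
      · exact ((hxt i n).2 u hu h).le) hu
    linarith
  have hkey : ∀ i n, τ i * ‖xt i n - x i n‖ ^ 2
      ≤ -⟪(I : ℝ) • y i n, xt i n - x i n⟫_ℝ + (G (x i n) - G (xt i n)) := by
    intro i n
    have h1 := hVI i n _ (hxK n i)
    have h2 := (hF1 i _ (hxK n i)).inner_sub_le (hxK n i) (hxtK i n)
      (hftgrad i _ (hxK n i) _ (hxK n i)) (hftgrad i _ (hxK n i) _ (hxtK i n))
    rw [hF2 i _ (hxK n i)] at h2
    rw [hπt, ← neg_sub (xt i n), inner_neg_right] at h1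
    simp only [inner_add_left, inner_sub_left] at h1 h2
    linarith
  -- Averages
  have hcolsum : ∀ n (v : Fin I → EuclideanSpace ℝ (Fin m)),
      ∑ i, ∑ j, W n i j • v j = ∑ j, v j := by
    intro n v
    rw [Finset.sum_comm]
    simp [← Finset.sum_smul, hWcol]
  have hysum : ∀ n, ∑ i, y i n = ∑ i, gf i (x i n) := by
    intro n
    induction n with
    | zero => simp [hy0]
    | succ n ih =>
      simp only [hyrec, Finset.sum_sub_distrib, Finset.sum_add_distrib, hcolsum, ih]
      abel
  have hxbarrec : ∀ n, xbar (n + 1)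
      = xbar n + α n • ((I : ℝ)⁻¹ • ∑ i, (xt i n - x i n)) := by
    intro n
    simp only [hxbar, hxrec, hcolsum, Finset.sum_add_distrib, ← Finset.smul_sum]
    module
  -- Contraction of the disagreement
  obtain ⟨T, hT, q, hq0, hq1, hcontr⟩ :=
    exists_spread_contraction (E := EuclideanSpace ℝ (Fin m)) (W := W) (B := 2 * B) hθ.1 hθ.2
      (fun n i j => (hWentries n i j).imp_right And.left) hWdiag hWrow (by omega)
      (fun n a b => by
        refine Relation.ReflTransGen.mono ?_ _ _ (hconn (n / B + 1) a b)
        rintro u v ⟨k, hk, hpos⟩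
        refine ⟨k, ?_, hpos⟩
        rw [Finset.mem_Ico] at hk ⊢
        have h1 := Nat.div_add_mod n B
        have h2 := Nat.mod_lt n hB
        have h3 : (n / B + 1) * B = B * (n / B) + B := by ring
        have h4 : (n / B + 1 + 1) * B = B * (n / B) + B + B := by ring
        omega)
  set Dx : ℕ → ℝ := fun n => spread fun i => x i n with hDx
  set Dy : ℕ → ℝ := fun n => spread fun i => y i n with hDy
  have hDx0 : ∀ n, 0 ≤ Dx n := fun n => spread_nonneg _
  have hDy0 : ∀ n, 0 ≤ Dy n := fun n => spread_nonneg _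
  have hDyrec := hcontr y (fun i n => gf i (x i (n + 1)) - gf i (x i n))
    (fun i n => by rw [hyrec, add_sub_assoc])
  have hDxrec := hcontr x (fun i n => ∑ j, W n i j • α n • (xt j n - x j n))
    (fun i n => by rw [hxrec]; simp only [smul_add, Finset.sum_add_distrib])
  have hxdev : ∀ i n, ‖x i n - xbar n‖ ≤ Dx n := fun i n => by
    rw [hxbar]
    simpa using norm_sub_mean_le_spread (fun i => x i n) i
  have hydev : ∀ i n, ‖y i n - (I : ℝ)⁻¹ • ∑ j, gf j (x j n)‖ ≤ Dy n := fun i n => by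
    rw [← hysum]
    simpa using norm_sub_mean_le_spread (fun i => y i n) i
  -- Boundedness of the trackers and of the directions
  obtain ⟨My, hMy⟩ : ∃ My, ∀ i n, ‖y i n‖ ≤ My := by
    obtain ⟨M, hM⟩ := bounded_of_delayed_contraction (b := 2 * (T * (I * (2 * LF)))) hDy0 hq1 hq0 hT
      fun n => (hDyrec n).trans (by
        gcongr
        calc _ ≤ ∑ _l ∈ Finset.range T, ∑ _k : Fin I, 2 * LF :=
              Finset.sum_le_sum fun l _ => Finset.sum_le_sum fun k _ =>
                (norm_sub_le _ _).trans
                  (by linarith [hgb k _ (hxK (n + l + 1) k), hgb k _ (hxK (n + l) k)])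
          _ = _ := by simp)
    refine ⟨M + LF, fun i n => ?_⟩
    have h1 : ‖(I : ℝ)⁻¹ • ∑ j, gf j (x j n)‖ ≤ LF := by
      rw [norm_smul, Real.norm_of_nonneg (inv_nonneg.2 hIpos.le), inv_mul_le_iff₀ hIpos]
      calc _ ≤ ∑ _j : Fin I, LF :=
            (norm_sum_le _ _).trans (Finset.sum_le_sum fun j _ => hgb j _ (hxK n j))
        _ = _ := by simp
    have h2 := norm_le_norm_sub_add (y i n) ((I : ℝ)⁻¹ • ∑ j, gf j (x j n))
    linarith [hydev i n, hM n]
  obtain ⟨Cd, hCd0, hCd⟩ : ∃ Cd : ℝ, 0 ≤ Cd ∧ ∀ i n, ‖xt i n - x i n‖ ≤ Cd := by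
    have hb : ∀ i n, ‖xt i n - x i n‖ ≤ (I * My + LG') / τ i := by
      intro i n
      rw [le_div_iff₀ (hτ i)]
      rcases (norm_nonneg (xt i n - x i n)).eq_or_lt' with h0 | h0
      · rw [h0, zero_mul]
        have := (norm_nonneg _).trans (hMy i n)
        positivity
      · refine le_of_mul_le_mul_right ?_ h0
        have h1 := hGlip _ (hxK n i) (xt i n)
        have h2 : -⟪(I : ℝ) • y i n, xt i n - x i n⟫_ℝ ≤ I * My * ‖xt i n - x i n‖ := by
          rw [← inner_neg_left]
          refine (real_inner_le_norm _ _).trans (mul_le_mul_of_nonneg_right ?_ h0.le)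
          rw [norm_neg, norm_smul, Real.norm_of_nonneg hIpos.le]
          exact mul_le_mul_of_nonneg_left (hMy i n) hIpos.le
        rw [norm_sub_rev] at h1
        nlinarith [hkey i n]
    have hnn : ∀ i, 0 ≤ (I * My + LG') / τ i := fun i => (norm_nonneg _).trans (hb i 0)
    exact ⟨∑ i, (I * My + LG') / τ i, Finset.sum_nonneg fun i _ => hnn i, fun i n =>
      (hb i n).trans (Finset.single_le_sum (f := fun i => (I * My + LG') / τ i)
        (fun i _ => hnn i) (Finset.mem_univ i))⟩
  have hδx : ∀ i n, ‖∑ j, W n i j • α n • (xt j n - x j n)‖ ≤ α n * Cd := by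
    intro i n
    calc _ ≤ ∑ j, W n i j * (α n * Cd) := by
          refine (norm_sum_le _ _).trans (Finset.sum_le_sum fun j _ => ?_)
          rw [norm_smul, norm_smul, Real.norm_of_nonneg (hWnn n i j),
            Real.norm_of_nonneg (hα n).1.le]
          exact mul_le_mul_of_nonneg_left
            (mul_le_mul_of_nonneg_left (hCd j n) (hα n).1.le) (hWnn n i j)
      _ = _ := by rw [← Finset.sum_mul, hWrow, one_mul]
  -- Square-summability of the disagreement
  have hDxsq : Summable fun n => Dx n ^ 2 := by
    refine summable_sq_of_delayed_contraction
      (d := fun n => ∑ k, ‖∑ j, W n k j • α n • (xt j n - x j n)‖) hDx0 hq1 hq0 hDxrec ?_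
    refine Summable.of_nonneg_of_le (fun n => sq_nonneg _) (fun n => ?_)
      (hαsq.mul_left ((I * Cd) ^ 2))
    rw [← mul_pow]
    refine pow_le_pow_left₀ (Finset.sum_nonneg fun _ _ => norm_nonneg _) ?_ 2
    calc _ ≤ ∑ _k : Fin I, α n * Cd := Finset.sum_le_sum fun k _ => hδx k n
      _ = _ := by simp; ring
  have hstep : ∀ i n, ‖x i (n + 1) - x i n‖ ≤ Dx n + α n * Cd := by
    intro i n
    have h1 : x i (n + 1) - x i n
        = ∑ j, W n i j • (x j n - x i n) + ∑ j, W n i j • α n • (xt j n - x j n) := by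
      rw [hxrec]
      simp only [smul_add, smul_sub, Finset.sum_add_distrib, Finset.sum_sub_distrib,
        ← Finset.sum_smul, hWrow, one_smul]
      abel
    rw [h1]
    refine (norm_add_le _ _).trans (add_le_add ?_ (hδx i n))
    calc _ ≤ ∑ j, W n i j * Dx n := by
          refine (norm_sum_le _ _).trans (Finset.sum_le_sum fun j _ => ?_)
          rw [norm_smul, Real.norm_of_nonneg (hWnn n i j)]
          exact mul_le_mul_of_nonneg_left (norm_sub_le_spread (fun i => x i n) j i) (hWnn n i j)
      _ = _ := by rw [← Finset.sum_mul, hWrow, one_mul]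
  have hDysq : Summable fun n => Dy n ^ 2 := by
    refine summable_sq_of_delayed_contraction
      (d := fun n => ∑ k, ‖gf k (x k (n + 1)) - gf k (x k n)‖) hDy0 hq1 hq0 hDyrec ?_
    refine Summable.of_nonneg_of_le (fun n => sq_nonneg _) (fun n => ?_)
      (((hDxsq.mul_left 2).add (hαsq.mul_left (2 * Cd ^ 2))).mul_left ((I * Lm) ^ 2))
    have h1 : ∑ k, ‖gf k (x k (n + 1)) - gf k (x k n)‖ ≤ I * Lm * (Dx n + α n * Cd) := by
      calc _ ≤ ∑ _k : Fin I, Lm * (Dx n + α n * Cd) := Finset.sum_le_sum fun k _ =>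
            (hLm k _ (hxK _ k) _ (hxK _ k)).trans (mul_le_mul_of_nonneg_left (hstep k n) hLm0)
        _ = _ := by simp; ring
    refine (pow_le_pow_left₀ (Finset.sum_nonneg fun _ _ => norm_nonneg _) h1 2).trans ?_
    rw [mul_pow]
    refine mul_le_mul_of_nonneg_left ?_ (sq_nonneg _)
    nlinarith [sq_nonneg (Dx n - α n * Cd)]
  set e : ℕ → ℝ := fun n => Dx n + Dy n with he
  have he0 : ∀ n, 0 ≤ e n := fun n => add_nonneg (hDx0 n) (hDy0 n)
  have hesq : Summable fun n => e n ^ 2 := by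
    refine Summable.of_nonneg_of_le (fun n => sq_nonneg _) (fun n => ?_)
      ((hDxsq.mul_left 2).add (hDysq.mul_left 2))
    simp only [he]
    nlinarith [sq_nonneg (Dx n - Dy n)]
  have hαe : Summable fun n => α n * e n := by
    refine Summable.of_nonneg_of_le (fun n => mul_nonneg (hα n).1.le (he0 n)) (fun n => ?_)
      (hαsq.add hesq)
    nlinarith [sq_nonneg (α n - e n), sq_nonneg (α n), sq_nonneg (e n)]
  have hetend : Tendsto e atTop (nhds 0) := by
    have h1 := hesq.tendsto_atTop_zero.sqrt
    simpa [Real.sqrt_sq (he0 _)] using h1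
  have hDxe : ∀ n, Dx n ≤ e n := fun n => le_add_of_nonneg_right (hDy0 n)
  have hDye : ∀ n, Dy n ≤ e n := fun n => le_add_of_nonneg_left (hDx0 n)
  have hxdev0 : ∀ i, Tendsto (fun n => ‖x i n - xbar n‖) atTop (nhds 0) := fun i =>
    squeeze_zero (fun _ => norm_nonneg _) (fun n => (hxdev i n).trans (hDxe n)) hetend
  refine ⟨?_, hxdev0⟩
  -- Gradient tracking
  have htrack : ∀ i n, ‖∑ j, gf j (xbar n) - (I : ℝ) • y i n‖ ≤ I * (Lm + 1) * e n := by
    intro i n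
    have h1 : ∑ j, gf j (xbar n) - (I : ℝ) • y i n = ∑ j, (gf j (xbar n) - gf j (x j n))
        - (I : ℝ) • (y i n - (I : ℝ)⁻¹ • ∑ j, gf j (x j n)) := by
      rw [Finset.sum_sub_distrib, smul_sub, smul_inv_smul₀ hIpos.ne']
      abel
    rw [h1]
    refine (norm_sub_le _ _).trans ?_
    have h2 : ‖∑ j, (gf j (xbar n) - gf j (x j n))‖ ≤ I * (Lm * e n) := by
      calc _ ≤ ∑ _j : Fin I, Lm * e n :=
            (norm_sum_le _ _).trans (Finset.sum_le_sum fun j _ =>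
              (hLm j _ (hxbarK n) _ (hxK n j)).trans (mul_le_mul_of_nonneg_left
                (by rw [norm_sub_rev]; exact (hxdev j n).trans (hDxe n)) hLm0))
        _ = _ := by simp
    have h3 : ‖(I : ℝ) • (y i n - (I : ℝ)⁻¹ • ∑ j, gf j (x j n))‖ ≤ I * e n := by
      rw [norm_smul, Real.norm_of_nonneg hIpos.le]
      exact mul_le_mul_of_nonneg_left ((hydev i n).trans (hDye n)) hIpos.le
    linarith
  -- Descent along the averages
  have hdnorm : ∀ n, ‖(I : ℝ)⁻¹ • ∑ i, (xt i n - x i n)‖ ≤ Cd := by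
    intro n
    rw [norm_smul, Real.norm_of_nonneg (inv_nonneg.2 hIpos.le), inv_mul_le_iff₀ hIpos]
    calc _ ≤ ∑ _j : Fin I, Cd := (norm_sum_le _ _).trans (Finset.sum_le_sum fun j _ => hCd j n)
      _ = _ := by simp
  have hdescent : ∀ n, (∑ i, f i (xbar (n + 1))) + G (xbar (n + 1))
      ≤ (∑ i, f i (xbar n)) + G (xbar n)
        - (I : ℝ)⁻¹ * (α n * ∑ i, τ i * ‖xt i n - x i n‖ ^ 2)
        + ((I * (Lm + 1) * Cd + LG') * (α n * e n) + I * (Lm * Cd ^ 2) * α n ^ 2) := by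
    intro n
    set d := (I : ℝ)⁻¹ • ∑ i, (xt i n - x i n) with hd
    have hdiffeq : xbar (n + 1) - xbar n = α n • d := by rw [hxbarrec, ← hd, add_sub_cancel_left]
    have hF : ∑ i, f i (xbar (n + 1)) ≤ ∑ i, f i (xbar n)
        + α n * ⟪∑ j, gf j (xbar n), d⟫_ℝ + I * (Lm * Cd ^ 2) * α n ^ 2 := by
      have h1 : ∀ i, f i (xbar (n + 1)) ≤ f i (xbar n)
          + α n * ⟪gf i (xbar n), d⟫_ℝ + Lm * Cd ^ 2 * α n ^ 2 := by
        intro i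
        have h2 := le_add_inner_add_sq_of_lipschitz_gradient hKcv (hgrad i) hLm0 (hLm i)
          (hxbarK n) (hxbarK (n + 1))
        rw [hdiffeq, inner_smul_right, norm_smul, mul_pow, Real.norm_eq_abs, sq_abs] at h2
        have h3 : ‖d‖ ^ 2 ≤ Cd ^ 2 := pow_le_pow_left₀ (norm_nonneg _) (hdnorm n) 2
        have h4 := mul_le_mul_of_nonneg_left h3 (mul_nonneg hLm0 (sq_nonneg (α n)))
        linarith
      refine (Finset.sum_le_sum fun i _ => h1 i).trans (le_of_eq ?_)
      simp only [Finset.sum_add_distrib, ← Finset.mul_sum, ← sum_inner]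
      simp
      ring
    have hG1 : G (xbar (n + 1)) ≤ (1 - α n) * G (xbar n) + α n * G (xbar n + d) := by
      have h1 := hG.2 (Set.mem_univ (xbar n)) (Set.mem_univ (xbar n + d))
        (sub_nonneg.2 (hα n).2) (hα n).1.le (by ring)
      have h2 : (1 - α n) • xbar n + α n • (xbar n + d) = xbar (n + 1) := by
        rw [hxbarrec, ← hd]; module
      rw [h2] at h1
      simpa using h1
    have hG2 : G (xbar n + d) ≤ (I : ℝ)⁻¹ * ∑ i, G (xt i n) := by
      have h1 : xbar n + d = ∑ i, (I : ℝ)⁻¹ • xt i n := by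
        rw [hxbar, hd, ← Finset.smul_sum, ← smul_add, ← Finset.sum_add_distrib]
        simp
      rw [h1, Finset.mul_sum]
      exact hG.map_sum_le (fun _ _ => inv_nonneg.2 hIpos.le) (by simp [hIpos.ne'])
        fun _ _ => Set.mem_univ _
    have hper : ∀ i, ⟪∑ j, gf j (xbar n), xt i n - x i n⟫_ℝ + G (xt i n) - G (xbar n)
        ≤ -(τ i * ‖xt i n - x i n‖ ^ 2) + (I * (Lm + 1) * Cd + LG') * e n := by
      intro i
      have h1 : ⟪∑ j, gf j (xbar n) - (I : ℝ) • y i n, xt i n - x i n⟫_ℝ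
          ≤ I * (Lm + 1) * e n * Cd :=
        (real_inner_le_norm _ _).trans (mul_le_mul (htrack i n) (hCd i n) (norm_nonneg _)
          ((norm_nonneg _).trans (htrack i n)))
      have h2 : G (x i n) - G (xbar n) ≤ LG' * e n :=
        (hGlip _ (hxK n i) _).trans
          (mul_le_mul_of_nonneg_left ((hxdev i n).trans (hDxe n)) hLG0)
      have h3 := hkey i n
      rw [inner_sub_left] at h1
      linarith
    have hsum : ⟪∑ j, gf j (xbar n), d⟫_ℝ + (I : ℝ)⁻¹ * ∑ i, G (xt i n) - G (xbar n)
        ≤ -((I : ℝ)⁻¹ * ∑ i, τ i * ‖xt i n - x i n‖ ^ 2)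
          + (I * (Lm + 1) * Cd + LG') * e n := by
      have h1 := mul_le_mul_of_nonneg_left (Finset.sum_le_sum fun i (_ : i ∈ Finset.univ) => hper i)
        (inv_nonneg.2 hIpos.le)
      simp only [Finset.sum_add_distrib, Finset.sum_sub_distrib, Finset.sum_neg_distrib,
        Finset.sum_const, Finset.card_univ, Fintype.card_fin, nsmul_eq_mul] at h1
      rw [hd, inner_smul_right, inner_sum]
      simp only [mul_add, mul_sub, inv_mul_cancel_left₀ hIpos.ne'] at h1 ⊢
      linarith
    have h1 := mul_le_mul_of_nonneg_left hsum (hα n).1.le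
    have h2 := mul_le_mul_of_nonneg_left hG2 (hα n).1.le
    linarith
  set ε : ℕ → ℝ := fun n =>
    (I * (Lm + 1) * Cd + LG') * (α n * e n) + I * (Lm * Cd ^ 2) * α n ^ 2 with hε
  have hεs : Summable ε := (hαe.mul_left _).add (hαsq.mul_left _)
  have hε0 : ∀ n, 0 ≤ ε n := fun n => by
    have := (hα n).1
    have := he0 n
    positivity
  have hdec0 : ∀ n, 0 ≤ α n * ∑ i, τ i * ‖xt i n - x i n‖ ^ 2 := fun n =>
    mul_nonneg (hα n).1.le (Finset.sum_nonneg fun i _ => mul_nonneg (hτ i).le (sq_nonneg _))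
  have hdescent_sum : ∀ n, (∑ i, f i (xbar n)) + G (xbar n)
      + (I : ℝ)⁻¹ * ∑ k ∈ Finset.range n, α k * ∑ i, τ i * ‖xt i k - x i k‖ ^ 2
      ≤ (∑ i, f i (xbar 0)) + G (xbar 0) + ∑' k, ε k := by
    intro n
    have h1 : (∑ i, f i (xbar n)) + G (xbar n)
        + (I : ℝ)⁻¹ * ∑ k ∈ Finset.range n, α k * ∑ i, τ i * ‖xt i k - x i k‖ ^ 2
        ≤ (∑ i, f i (xbar 0)) + G (xbar 0) + ∑ k ∈ Finset.range n, ε k := by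
      induction n with
      | zero => simp
      | succ n ih =>
        rw [Finset.sum_range_succ, Finset.sum_range_succ]
        have h2 := hdescent n
        simp only [hε] at ih ⊢
        linarith
    have h2 := hεs.sum_le_tsum (Finset.range n) fun k _ => hε0 k
    linarith
  -- Boundedness of the averages
  obtain ⟨R, hR⟩ : ∃ R : ℝ, ∀ n, ‖xbar n‖ ≤ R := by
    obtain ⟨r, hr⟩ := hcoer ((∑ i, f i (xbar 0)) + G (xbar 0) + ∑' k, ε k + 1)
    refine ⟨r, fun n => ?_⟩
    by_contra! hlt
    have h1 := hr _ (hxbarK n) hlt.le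
    have h2 := hdescent_sum n
    have h3 : 0 ≤ (I : ℝ)⁻¹ * ∑ k ∈ Finset.range n, α k * ∑ i, τ i * ‖xt i k - x i k‖ ^ 2 :=
      mul_nonneg (inv_nonneg.2 hIpos.le) (Finset.sum_nonneg fun k _ => hdec0 k)
    linarith
  refine ⟨⟨R, hR⟩, ?_⟩
  -- Vanishing of the directions
  have hsumdec : Summable fun n => α n * ∑ i, τ i * ‖xt i n - x i n‖ ^ 2 := by
    obtain ⟨c, hc⟩ : ∃ c, ∀ n, c ≤ (∑ i, f i (xbar n)) + G (xbar n) := by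
      have hcomp : IsCompact (K ∩ Metric.closedBall 0 R) :=
        (isCompact_closedBall _ _).inter_left hKcl
      have hcont : ContinuousOn (fun u => (∑ i, f i u) + G u) (K ∩ Metric.closedBall 0 R) :=
        (continuousOn_finsetSum _ fun i _ u hu =>
          (hgrad i u hu.1).continuousAt.continuousWithinAt).add hGc.continuousOn
      obtain ⟨c, hc⟩ := hcomp.bddBelow_image hcont
      exact ⟨c, fun n => hc ⟨xbar n, ⟨hxbarK n, mem_closedBall_zero_iff.2 (hR n)⟩, rfl⟩⟩
    refine summable_of_sum_range_le
      (c := I * ((∑ i, f i (xbar 0)) + G (xbar 0) + ∑' k, ε k - c)) hdec0 fun n => ?_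
    rw [← inv_mul_le_iff₀ hIpos]
    linarith [hdescent_sum n, hc n]
  have hxbarvar : ∀ n k, ‖xbar n - xbar (n + k)‖ ≤ Cd * ∑ l ∈ Finset.range k, α (n + l) := by
    intro n k
    induction k with
    | zero => simp
    | succ k ih =>
      rw [Finset.sum_range_succ, mul_add, ← add_assoc, hxbarrec (n + k), ← sub_sub]
      refine (norm_sub_le _ _).trans (add_le_add ih ?_)
      rw [norm_smul, Real.norm_of_nonneg (hα _).1.le, mul_comm]
      exact mul_le_mul_of_nonneg_right (hdnorm _) (hα _).1.le
  have hΔvar : ∀ i, ∃ C : ℝ, 0 ≤ C ∧ ∀ n k, ‖xt i n - x i n‖ - ‖xt i k - x i k‖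
      ≤ C * (‖xbar n - xbar k‖ + e n + e k) := by
    intro i
    refine ⟨(|Lt| + I * (1 + Lm) + Lm) / τ i + 1, by have := hτ i; positivity, fun n k => ?_⟩
    set X := ‖xbar n - xbar k‖ + e n + e k with hX
    have hxX : ∀ j, ‖x j n - x j k‖ ≤ X := by
      intro j
      have h1 : x j n - x j k = (x j n - xbar n) + (xbar n - xbar k) - (x j k - xbar k) := by abel
      rw [h1]
      refine (norm_sub_le _ _).trans ?_
      have h2 := norm_add_le (x j n - xbar n) (xbar n - xbar k)
      linarith [hxdev j n, hxdev j k, hDxe n, hDxe k]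
    have hyX : ‖y i n - y i k‖ ≤ (1 + Lm) * X := by
      set μ : ℕ → EuclideanSpace ℝ (Fin m) := fun n => (I : ℝ)⁻¹ • ∑ j, gf j (x j n) with hμ
      have h1 : y i n - y i k = (y i n - μ n) + (μ n - μ k) - (y i k - μ k) := by abel
      have h2 : ‖μ n - μ k‖ ≤ Lm * X := by
        simp only [hμ]
        rw [← smul_sub, ← Finset.sum_sub_distrib, norm_smul,
          Real.norm_of_nonneg (inv_nonneg.2 hIpos.le), inv_mul_le_iff₀ hIpos]
        calc _ ≤ ∑ _j : Fin I, Lm * X :=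
              (norm_sum_le _ _).trans (Finset.sum_le_sum fun j _ =>
                (hLm j _ (hxK n j) _ (hxK k j)).trans (mul_le_mul_of_nonneg_left (hxX j) hLm0))
          _ = _ := by simp
      rw [h1]
      refine (norm_sub_le _ _).trans ?_
      have h3 := norm_add_le (y i n - μ n) (μ n - μ k)
      have h4 := norm_nonneg (xbar n - xbar k)
      linarith [hydev i n, hydev i k, hDye n, hDye k]
    have hπX : ‖πt i n - πt i k‖ ≤ (I * (1 + Lm) + Lm) * X := by
      have h1 : πt i n - πt i k
          = (I : ℝ) • (y i n - y i k) - (gf i (x i n) - gf i (x i k)) := by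
        rw [hπt, hπt, smul_sub]; abel
      rw [h1]
      refine (norm_sub_le _ _).trans ?_
      rw [norm_smul, Real.norm_of_nonneg hIpos.le]
      have h2 := mul_le_mul_of_nonneg_left hyX hIpos.le
      have h3 := (hLm i _ (hxK n i) _ (hxK k i)).trans (mul_le_mul_of_nonneg_left (hxX i) hLm0)
      linarith
    have hxtX : ‖xt i n - xt i k‖ ≤ (|Lt| + I * (1 + Lm) + Lm) / τ i * X := by
      have h1 := hVI i n _ (hxtK i k)
      rw [← neg_sub (G (xt i n)) (G (xt i k)), ← sub_eq_add_neg] at h1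
      have h2 := mul_norm_sub_le_of_variational (hVI i k _ (hxtK i n)) h1
        ((hF1 i _ (hxK n i)).inner_sub_le (hxtK i k) (hxtK i n)
          (hftgrad i _ (hxK n i) _ (hxtK i k)) (hftgrad i _ (hxK n i) _ (hxtK i n)))
      have h3 : ‖gft i (xt i k) (x i n) - gft i (xt i k) (x i k)‖ ≤ |Lt| * X :=
        (hF3 i _ (hxtK i k) _ (hxK n i) _ (hxK k i)).trans
          (mul_le_mul (le_abs_self _) (hxX i) (norm_nonneg _) (abs_nonneg _))
      rw [div_mul_eq_mul_div, le_div_iff₀ (hτ i)]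
      linarith
    have h1 := norm_sub_norm_le (xt i n - x i n) (xt i k - x i k)
    have h2 : xt i n - x i n - (xt i k - x i k) = (xt i n - xt i k) - (x i n - x i k) := by abel
    rw [h2] at h1
    have h3 := norm_sub_le (xt i n - xt i k) (x i n - x i k)
    linarith [hxX i]
  have hΔ0 : ∀ i, Tendsto (fun n => ‖xt i n - x i n‖) atTop (nhds 0) := by
    intro i
    obtain ⟨C, hC0, hC⟩ := hΔvar i
    refine tendsto_zero_of_summable_mul_sq (e := fun n => C * e n) (C := C * Cd + 1)
      (by positivity) (fun n => norm_nonneg _) (fun n => (hα n).1.le) hαdiv ?_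
      (by simpa using hetend.const_mul C) fun n k => ?_
    · refine Summable.of_nonneg_of_le (fun n => mul_nonneg (hα n).1.le (sq_nonneg _)) (fun n => ?_)
        (hsumdec.mul_left (τ i)⁻¹)
      rw [le_inv_mul_iff₀ (hτ i), mul_left_comm]
      exact mul_le_mul_of_nonneg_left (Finset.single_le_sum
        (f := fun i => τ i * ‖xt i n - x i n‖ ^ 2)
        (fun i _ => mul_nonneg (hτ i).le (sq_nonneg _)) (Finset.mem_univ i)) (hα n).1.le
    · have h1 := mul_le_mul_of_nonneg_left (hxbarvar n k) hC0
      have h2 : 0 ≤ ∑ l ∈ Finset.range k, α (n + l) :=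
        Finset.sum_nonneg fun l _ => (hα _).1.le
      linarith [hC n (n + k)]
  -- Stationarity of the limit points
  intro p hp
  obtain ⟨ℓ, hℓ, hℓp⟩ := mapClusterPt_iff_ultrafilter.1 hp
  have hpK : p ∈ K := hKcl.mem_of_tendsto hℓp (Eventually.of_forall hxbarK)
  set i₀ : Fin I := ⟨0, hI⟩
  have hgf : ∀ i, ∀ v : ℕ → EuclideanSpace ℝ (Fin m), Tendsto v ℓ (nhds p) →
      Tendsto (fun n => gf i (v n)) ℓ (nhds (gf i p)) := fun i v hv =>
    ((hgradcont i).continuousAt (hUo.mem_nhds (hKUo hpK))).tendsto.comp hv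
  have hxp : Tendsto (x i₀) ℓ (nhds p) := by
    have h1 := (tendsto_zero_iff_norm_tendsto_zero.2 ((hxdev0 i₀).mono_left hℓ)).add hℓp
    simpa using h1
  have hxtp : Tendsto (xt i₀) ℓ (nhds p) := by
    have h1 := (tendsto_zero_iff_norm_tendsto_zero.2 ((hΔ0 i₀).mono_left hℓ)).add hxp
    simpa using h1
  have hyp : Tendsto (fun n => (I : ℝ) • y i₀ n) ℓ (nhds (∑ j, gf j p)) := by
    have h1 : Tendsto (fun n => ∑ j, gf j (xbar n) - (I : ℝ) • y i₀ n) ℓ (nhds 0) :=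
      tendsto_zero_iff_norm_tendsto_zero.2 (squeeze_zero (fun _ => norm_nonneg _)
        (htrack i₀) (by simpa using (hetend.mono_left hℓ).const_mul (I * (Lm + 1))))
    have h2 : Tendsto (fun n => ∑ j, gf j (xbar n)) ℓ (nhds (∑ j, gf j p)) :=
      tendsto_finsetSum _ fun j _ => hgf j xbar hℓp
    simpa using h2.sub h1
  have hgftp : Tendsto (fun n => gft i₀ (xt i₀ n) (x i₀ n)) ℓ (nhds (gf i₀ p)) := by
    have h1 : Tendsto (fun n => gft i₀ (xt i₀ n) (x i₀ n) - gf i₀ (xt i₀ n)) ℓ (nhds 0) := by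
      refine tendsto_zero_iff_norm_tendsto_zero.2 (squeeze_zero (fun _ => norm_nonneg _)
        (fun n => ?_) (by simpa using ((hΔ0 i₀).mono_left hℓ).const_mul Lt))
      have := hF3 i₀ _ (hxtK i₀ n) _ (hxK n i₀) _ (hxtK i₀ n)
      rwa [hF2 i₀ _ (hxtK i₀ n), norm_sub_rev (x i₀ n)] at this
    simpa using h1.add (hgf i₀ _ hxtp)
  have hlim : ∀ u ∈ K, 0 ≤ ⟪∑ j, gf j p, u - p⟫_ℝ + G u - G p := by
    intro u hu
    have h1 : Tendsto (fun n => gft i₀ (xt i₀ n) (x i₀ n) + πt i₀ n) ℓ (nhds (∑ j, gf j p)) := by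
      have h2 := hgftp.add (hyp.sub (hgf i₀ _ hxp))
      rw [add_sub_cancel] at h2
      simpa only [hπt] using h2
    have h3 := (h1.inner (hxtp.const_sub u)).add (((hGc.tendsto p).comp hxtp).const_sub (G u))
    have h4 := ge_of_tendsto' h3 fun n => hVI i₀ n u hu
    linarith
  exact ⟨hpK, exists_subgradient_of_variational hG hGc hKcv hpK hlim⟩
end
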